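/- Let X be a compact submanifold of ℝ^n satisfying property P everywhere. Then N_X(B) ≪ B log B when dim X = 1, N_X(B) ≪ B² exp(c√(log B)) when dim X = 2, and N_X(B) ≪ B^{dim X}(log B)^κ when dim X ≥ 3, where c, κ and the implied constants depend only on X. -/

import Mathlib

open MeasureTheory

/-- Hessian matrix of `f` at `x`. -/
noncomputable def hess {m : ℕ} (f : (Fin m → ℝ) → ℝ) (x : Fin m → ℝ) :
    Matrix (Fin m) (Fin m) ℝ :=
  Matrix.of fun i j => fderiv ℝ (fun y => fderiv ℝ f y (Pi.single j 1)) x (Pi.single i 1)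

/-- Combine a vector in `ℝ^m` and a vector in `ℝ^{n-m}` into a vector in `ℝ^n`. -/
noncomputable def appendV2 (n m : ℕ) (y : Fin m → ℝ) (z : Fin (n - m) → ℝ) : Fin n → ℝ :=
  fun i => if h : (i : ℕ) < m then y ⟨i, h⟩
    else z ⟨(i : ℕ) - m, by have := i.isLt; omega⟩

/-- The number of rational points `a/q` on `X` with denominator `1 ≤ q ≤ B`,
counted with multiplicity of representation. -/
noncomputable def NX {n : ℕ} (X : Set (Fin n → ℝ)) (B : ℝ) : ℕ :=
  Nat.card {p : (Fin n → ℤ) × ℤ | 1 ≤ p.2 ∧ (p.2 : ℝ) ≤ B ∧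
    (fun i => (p.1 i : ℝ) / (p.2 : ℝ)) ∈ X}

/-- The squared modulus of the exponential sum with frequencies in `S`. -/
noncomputable def energy {ι : Type*} [Fintype ι] (S : Finset (ι → ℤ)) (α : ι → ℝ) : ℝ :=
  (∑ p ∈ S, Real.cos (2 * Real.pi * ∑ i, p i * α i)) ^ 2 +
    (∑ p ∈ S, Real.sin (2 * Real.pi * ∑ i, p i * α i)) ^ 2

section energy
variable {ι : Type*} [Fintype ι]

lemma energy_nonneg (S : Finset (ι → ℤ)) (α : ι → ℝ) : 0 ≤ energy S α := by
  unfold energy; positivity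

lemma continuous_energy (S : Finset (ι → ℤ)) : Continuous (energy S) := by
  unfold energy; fun_prop

lemma energy_eq_sum (S : Finset (ι → ℤ)) (α : ι → ℝ) :
    energy S α = ∑ p ∈ S, ∑ r ∈ S,
      Real.cos (2 * Real.pi * ∑ i, (((p i - r i : ℤ) : ℝ)) * α i) := by
  unfold energy
  rw [sq, sq, Finset.sum_mul_sum, Finset.sum_mul_sum, ← Finset.sum_add_distrib]
  refine Finset.sum_congr rfl fun p _ => ?_
  rw [← Finset.sum_add_distrib]
  refine Finset.sum_congr rfl fun r _ => ?_
  rw [← Real.cos_sub, ← mul_sub, ← Finset.sum_sub_distrib]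
  simp [sub_mul]

lemma energy_add_int (S : Finset (ι → ℤ)) (α : ι → ℝ) (h : ι → ℤ) :
    energy S (α + fun i => (h i : ℝ)) = energy S α := by
  rw [energy_eq_sum, energy_eq_sum]
  refine Finset.sum_congr rfl fun p _ => Finset.sum_congr rfl fun r _ => ?_
  have : 2 * Real.pi * ∑ i, (((p i - r i : ℤ) : ℝ)) * (α + fun i => (h i : ℝ)) i
      = 2 * Real.pi * ∑ i, (((p i - r i : ℤ) : ℝ)) * α i
        + (∑ i, (p i - r i) * h i : ℤ) * (2 * Real.pi) := by
    simp only [Pi.add_apply, mul_add, Finset.sum_add_distrib]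
    push_cast
    ring
  rw [this, Real.cos_add_int_mul_two_pi]

lemma integral_cos_unitCube (k : ι → ℤ) (hk : k ≠ 0) :
    ∫ α in Set.pi Set.univ (fun _ : ι => Set.Ico (0 : ℝ) 1),
      Real.cos (2 * Real.pi * ∑ i, k i * α i) = 0 := by
  have h1 : ∀ α : ι → ℝ, Real.cos (2 * Real.pi * ∑ i, k i * α i) =
      (∏ i, Complex.exp ((2 * Real.pi * k i * Complex.I) * α i)).re := by
    intro α
    rw [← Complex.exp_sum, ← Complex.exp_ofReal_mul_I_re]
    congr 2
    push_cast
    rw [Finset.mul_sum, Finset.sum_mul]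
    exact Finset.sum_congr rfl fun i _ => by ring
  have h2 : ∫ α in Set.pi Set.univ (fun _ : ι => Set.Ico (0 : ℝ) 1),
      ∏ i, Complex.exp ((2 * Real.pi * k i * Complex.I) * α i) = 0 := by
    rw [volume_pi, Measure.restrict_pi_pi,
      integral_fintype_prod_eq_prod (fun i (t : ℝ) =>
        Complex.exp ((2 * Real.pi * k i * Complex.I) * t))]
    obtain ⟨i, hi⟩ := Function.ne_iff.mp hk
    refine Finset.prod_eq_zero (Finset.mem_univ i) ?_
    rw [integral_Ico_eq_integral_Ioc, ← intervalIntegral.integral_of_le zero_le_one,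
      integral_exp_mul_complex]
    · have : Complex.exp (2 * Real.pi * k i * Complex.I * (1 : ℝ)) = 1 := by
        rw [Complex.exp_eq_one_iff]; exact ⟨k i, by push_cast; ring⟩
      rw [this]; simp
    · simpa [Real.pi_ne_zero] using hi
  simp_rw [h1]
  have h_integrable : Integrable (fun α : ι → ℝ =>
      ∏ i, Complex.exp ((2 * Real.pi * k i * Complex.I) * α i))
      (volume.restrict (Set.pi Set.univ (fun _ : ι => Set.Ico (0 : ℝ) 1))) := by
    have hc : Continuous (fun α : ι → ℝ =>
      ∏ i, Complex.exp ((2 * Real.pi * k i * Complex.I) * α i)) := by fun_prop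
    have : IntegrableOn (fun α : ι → ℝ =>
      ∏ i, Complex.exp ((2 * Real.pi * k i * Complex.I) * α i)) (Set.Icc 0 1) :=
      hc.continuousOn.integrableOn_compact isCompact_Icc
    refine this.mono_set fun α hα => ?_
    rw [Set.mem_univ_pi] at hα
    exact ⟨fun i => (hα i).1, fun i => (hα i).2.le⟩
  have := integral_re h_integrable
  simp only [RCLike.re_eq_complex_re] at this
  rw [this, h2]; simp

lemma volume_unitCube :
    volume (Set.pi Set.univ (fun _ : ι => Set.Ico (0 : ℝ) 1)) = 1 := by
  rw [Real.volume_pi_Ico]; simp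

lemma lintegral_energy_unitCube (S : Finset (ι → ℤ)) :
    ∫⁻ α in Set.pi Set.univ (fun _ : ι => Set.Ico (0 : ℝ) 1),
      ENNReal.ofReal (energy S α) = S.card := by
  classical
  have hsub : Set.pi Set.univ (fun _ : ι => Set.Ico (0 : ℝ) 1) ⊆ Set.Icc 0 1 := by
    intro α hα
    rw [Set.mem_univ_pi] at hα
    exact ⟨fun i => (hα i).1, fun i => (hα i).2.le⟩
  have hi : ∀ {g : (ι → ℝ) → ℝ}, Continuous g → IntegrableOn g
      (Set.pi Set.univ (fun _ : ι => Set.Ico (0 : ℝ) 1)) := fun hg =>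
    (hg.continuousOn.integrableOn_compact isCompact_Icc).mono_set hsub
  rw [← ofReal_integral_eq_lintegral_ofReal (hi (continuous_energy S))
    (Filter.Eventually.of_forall fun α => energy_nonneg S α)]
  have : ∫ α in Set.pi Set.univ (fun _ : ι => Set.Ico (0 : ℝ) 1), energy S α = S.card := by
    simp_rw [energy_eq_sum]
    rw [integral_finsetSum _ (fun p _ => hi (by fun_prop))]
    have : ∀ p ∈ S, ∫ α in Set.pi Set.univ (fun _ : ι => Set.Ico (0 : ℝ) 1), ∑ r ∈ S,
        Real.cos (2 * Real.pi * ∑ i, (((p i - r i : ℤ) : ℝ)) * α i) = 1 := by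
      intro p hp
      rw [integral_finsetSum _ (fun r _ => hi (by fun_prop)), Finset.sum_eq_single p]
      · simp [Measure.real, volume_unitCube]
      · intro r _ hr
        exact integral_cos_unitCube (p - r) (sub_ne_zero.mpr hr.symm)
      · exact fun h => absurd hp h
    rw [Finset.sum_congr rfl this]; simp
  rw [this]; simp

/-- A set of integer points that is nearly orthogonal modulo one to all of `Q` has cardinality
controlled by the number of integer points of the difference set of `Q`. -/
theorem card_mul_volume_le {Q : Set (ι → ℝ)} (hQ : MeasurableSet Q) (S H : Finset (ι → ℤ))
    (hS : ∀ p ∈ S, ∀ α ∈ Q, |∑ i, p i * α i| ≤ 1 / 8)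
    (hH : ∀ h : ι → ℤ, ∀ α ∈ Q, ∀ β ∈ Q, (∀ i, (h i : ℝ) = α i - β i) → h ∈ H) :
    S.card * volume Q ≤ 4 * H.card := by
  classical
  rcases S.eq_empty_or_nonempty with rfl | hne
  · simp
  set U := Set.pi Set.univ (fun _ : ι => Set.Ico (0 : ℝ) 1) with hU
  have hUm : MeasurableSet U := MeasurableSet.univ_pi fun _ => measurableSet_Ico
  set g : (ι → ℝ) → ENNReal := fun α => ENNReal.ofReal (energy S α) with hg
  have hgm : Measurable g := (continuous_energy S).measurable.ennreal_ofReal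
  have hlow : (S.card : ENNReal) ^ 2 / 4 * volume Q ≤ ∫⁻ α in Q, g α := by
    rw [← setLIntegral_const]
    refine setLIntegral_mono' hQ fun α hα => ?_
    have h1 : (S.card : ℝ) * (1 / 2) ≤ ∑ p ∈ S, Real.cos (2 * Real.pi * ∑ i, p i * α i) := by
      rw [← nsmul_eq_mul]
      refine Finset.card_nsmul_le_sum _ _ _ fun p hp => ?_
      rw [← Real.cos_pi_div_three, ← Real.cos_abs (2 * _ * _)]
      have := hS p hp α hα
      have hpi := Real.pi_pos
      refine Real.cos_le_cos_of_nonneg_of_le_pi (abs_nonneg _) (by linarith) ?_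
      rw [abs_mul, abs_of_pos (by positivity)]
      nlinarith
    have h2 : (S.card : ℝ) ^ 2 / 4 ≤ energy S α := by
      unfold energy
      have : (0 : ℝ) ≤ S.card := by positivity
      nlinarith [sq_nonneg (∑ p ∈ S, Real.sin (2 * Real.pi * ∑ i, p i * α i))]
    calc (S.card : ENNReal) ^ 2 / 4 = ENNReal.ofReal ((S.card : ℝ) ^ 2 / 4) := by
          rw [ENNReal.ofReal_div_of_pos (by norm_num), ENNReal.ofReal_pow (by positivity)]
          simp
      _ ≤ _ := ENNReal.ofReal_le_ofReal h2
  have hup : ∫⁻ α in Q, g α ≤ H.card * S.card := by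
    let cell : (ι → ℤ) → Set (ι → ℝ) := fun h => {α | ∀ i, ⌊α i⌋ = h i}
    have hcm : ∀ h, MeasurableSet (cell h) := by
      intro h
      have : cell h = ⋂ i, (fun α : ι → ℝ => ⌊α i⌋) ⁻¹' {h i} := by
        ext α; simp [cell]
      rw [this]
      exact MeasurableSet.iInter fun i =>
        (Int.measurable_floor.comp (measurable_pi_apply i)) (measurableSet_singleton _)
    have hun : Q = ⋃ h, Q ∩ cell h := by
      ext α
      simp only [Set.mem_iUnion, Set.mem_inter_iff, cell, Set.mem_ofPred_eq]
      exact ⟨fun hα => ⟨fun i => ⌊α i⌋, hα, fun i => rfl⟩, fun ⟨_, hα, _⟩ => hα⟩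
    have hdis : Pairwise (Function.onFun Disjoint fun h => Q ∩ cell h) := by
      intro h k hhk
      rw [Function.onFun, Set.disjoint_left]
      rintro α ⟨_, h1⟩ ⟨_, h2⟩
      exact hhk (funext fun i => (h1 i).symm.trans (h2 i))
    have hcell : ∀ h, ∫⁻ α in Q ∩ cell h, g α =
        ∫⁻ α in U, (Q.indicator 1 (α + fun i => (h i : ℝ)) : ENNReal) * g α := by
      intro h
      rw [← lintegral_indicator (hQ.inter (hcm h)), ← lintegral_indicator hUm,
        ← lintegral_add_right_eq_self _ (fun i => (h i : ℝ))]
      refine lintegral_congr fun α => ?_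
      have hmem : (α + fun i => (h i : ℝ)) ∈ cell h ↔ α ∈ U := by
        simp only [cell, Set.mem_ofPred_eq, hU, Set.mem_univ_pi, Pi.add_apply, Int.floor_add_intCast,
          Set.mem_Ico]
        refine forall_congr' fun i => ?_
        rw [add_eq_right, Int.floor_eq_zero_iff, Set.mem_Ico]
      have hgg : g (α + fun i => (h i : ℝ)) = g α := by simp only [hg, energy_add_int]
      by_cases hα : α ∈ U
      · by_cases hq : (α + fun i => (h i : ℝ)) ∈ Q
        · rw [Set.indicator_of_mem (Set.mem_inter hq (hmem.mpr hα)),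
            Set.indicator_of_mem hα, Set.indicator_of_mem hq, hgg]
          simp
        · rw [Set.indicator_of_notMem (fun hh => hq hh.1), Set.indicator_of_mem hα,
            Set.indicator_of_notMem hq]
          simp
      · rw [Set.indicator_of_notMem (fun hh => hα (hmem.mp hh.2)), Set.indicator_of_notMem hα]
    have hcount : ∀ α, ∑' h : ι → ℤ, (Q.indicator 1 (α + fun i => (h i : ℝ)) : ENNReal)
        ≤ H.card := by
      intro α
      by_cases hex : ∃ h : ι → ℤ, (α + fun i => (h i : ℝ)) ∈ Q
      · obtain ⟨h₁, hh₁⟩ := hex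
        have : ∀ h ∉ H.image (fun k => k + h₁),
            (Q.indicator 1 (α + fun i => (h i : ℝ)) : ENNReal) = 0 := by
          intro h hh
          refine Set.indicator_of_notMem (fun hq => hh ?_) _
          refine Finset.mem_image.mpr ⟨h - h₁, hH _ _ hq _ hh₁ fun i => ?_, by simp⟩
          simp
        rw [tsum_eq_sum this]
        calc _ ≤ ∑ h ∈ H.image (fun k => k + h₁), (1 : ENNReal) :=
              Finset.sum_le_sum fun h _ =>
                Set.indicator_le_self' (f := (1 : (ι → ℝ) → ENNReal)) (by simp) _
          _ ≤ (H.card : ENNReal) := by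
              simp only [Finset.sum_const, nsmul_eq_mul, mul_one]
              exact_mod_cast Finset.card_image_le
      · push Not at hex
        rw [ENNReal.tsum_eq_zero.mpr fun h => Set.indicator_of_notMem (hex h) _]
        simp
    calc ∫⁻ α in Q, g α = ∑' h, ∫⁻ α in Q ∩ cell h, g α := by
          conv_lhs => rw [hun]
          exact lintegral_iUnion (fun h => hQ.inter (hcm h)) hdis g
      _ = ∫⁻ α in U, ∑' h : ι → ℤ, (Q.indicator 1 (α + fun i => (h i : ℝ)) : ENNReal) * g α := by
          rw [lintegral_tsum]
          · exact tsum_congr hcell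
          · intro h
            refine (Measurable.mul ?_ hgm).aemeasurable
            exact ((measurable_const (a := (1 : ENNReal))).indicator hQ).comp
              (measurable_id.add_const _)
      _ ≤ ∫⁻ α in U, H.card * g α := by
          refine lintegral_mono fun α => ?_
          simp only
          rw [ENNReal.tsum_mul_right]
          gcongr
          exact hcount α
      _ = H.card * S.card := by
          rw [lintegral_const_mul _ hgm, lintegral_energy_unitCube]
  have h3 := hlow.trans hup
  have hc0 : (S.card : ENNReal) ≠ 0 := by
    simpa using hne.ne_empty
  have hct : (S.card : ENNReal) ≠ ⊤ := ENNReal.natCast_ne_top _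
  have h4 : (S.card : ENNReal) * (S.card * volume Q) ≤ S.card * (4 * H.card) := by
    calc (S.card : ENNReal) * (S.card * volume Q) = 4 * ((S.card : ENNReal) ^ 2 / 4 * volume Q) := by
          rw [← mul_assoc, ← mul_assoc, ENNReal.mul_div_cancel (by norm_num) (by norm_num), sq]
      _ ≤ 4 * (H.card * S.card) := by gcongr
      _ = _ := by ring
  exact (ENNReal.mul_le_mul_iff_right hc0 hct).mp h4

end energy

/-- The inverse of the shear attached to a point `x`, a value `f` and a slope `G`. -/
noncomputable def shear {m : ℕ} (x G : Fin m → ℝ) (f : ℝ) :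
    Matrix (Unit ⊕ (Fin m ⊕ Unit)) (Unit ⊕ (Fin m ⊕ Unit)) ℝ :=
  Matrix.fromBlocks 1 (Matrix.of fun _ => Sum.elim (fun i => -x i) fun _ => ∑ i, G i * x i - f) 0
    (Matrix.fromBlocks 1 (Matrix.of fun i _ => -G i) 0 1)

lemma det_shear {m : ℕ} (x G : Fin m → ℝ) (f : ℝ) : (shear x G f).det = 1 := by
  simp [shear, Matrix.det_fromBlocks_zero₂₁]

lemma shear_mulVec_last {m : ℕ} (x G : Fin m → ℝ) (f : ℝ) (β : Unit ⊕ (Fin m ⊕ Unit) → ℝ) :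
    (shear x G f).mulVec β (.inr (.inr ())) = β (.inr (.inr ())) := by
  simp [shear, Matrix.mulVec, dotProduct, Fintype.sum_sum_type]

lemma shear_mulVec_mid {m : ℕ} (x G : Fin m → ℝ) (f : ℝ) (β : Unit ⊕ (Fin m ⊕ Unit) → ℝ)
    (i : Fin m) : (shear x G f).mulVec β (.inr (.inl i)) =
      β (.inr (.inl i)) - G i * β (.inr (.inr ())) := by
  simp [shear, Matrix.mulVec, dotProduct, Fintype.sum_sum_type, Matrix.one_apply, sub_eq_add_neg]

lemma shear_mulVec_first {m : ℕ} (x G : Fin m → ℝ) (f : ℝ) (β : Unit ⊕ (Fin m ⊕ Unit) → ℝ) :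
    (shear x G f).mulVec β (.inl ()) =
      β (.inl ()) - ∑ i, x i * β (.inr (.inl i)) +
        (∑ i, G i * x i - f) * β (.inr (.inr ())) := by
  simp [shear, Matrix.mulVec, dotProduct, Fintype.sum_sum_type]
  ring

/-- Duality between the integer points of a cap and those of its polar body. -/
theorem cap_duality (m : ℕ) : ∃ C > (0 : ℝ), ∀ (x G : Fin m → ℝ) (f B R δ : ℝ),
    0 < B → 0 < R → 0 < δ → ∀ S : Finset (ℤ × (Fin m → ℤ) × ℤ),
    (∀ p ∈ S, |(p.1 : ℝ)| ≤ 2 * B ∧ (∀ i, |(p.2.1 i : ℝ) - p.1 * x i| ≤ R) ∧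
      |(p.2.2 : ℝ) - p.1 * f - ∑ i, G i * (p.2.1 i - p.1 * x i)| ≤ δ) →
    ∃ H : Finset (ℤ × (Fin m → ℤ) × ℤ),
      (∀ h ∈ H, |(h.1 : ℝ) + ∑ i, h.2.1 i * x i + h.2.2 * f| ≤ 1 / (2 * B) ∧
        (∀ i, |(h.2.1 i : ℝ) + h.2.2 * G i| ≤ 1 / (2 * R)) ∧ |(h.2.2 : ℝ)| ≤ 1 / (2 * δ)) ∧
      (S.card : ℝ) ≤ C * (B * R ^ m * δ) * H.card := by
  classical
  set κ : ℝ := 1 / (8 * (m + 3)) with hκ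
  have hκ0 : 0 < κ := by positivity
  have hκ1 : κ * (m + 3) = 1 / 8 := by rw [hκ]; field_simp
  have hκ4 : 2 * κ ≤ 1 / 2 := by
    have : κ * 3 ≤ 1 / 8 := by
      rw [← hκ1]; gcongr; linarith [(Nat.cast_nonneg m : (0 : ℝ) ≤ m)]
    linarith
  refine ⟨4 / (2 * κ) ^ (m + 2), by positivity, fun x G f B R δ hB hR hδ S hS => ?_⟩
  let r : Unit ⊕ (Fin m ⊕ Unit) → ℝ := Sum.elim (fun _ => κ / B)
    (Sum.elim (fun _ => κ / R) fun _ => κ / δ)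
  have hr : ∀ i, 0 < r i := by
    rintro (i | i | i) <;> simp only [r, Sum.elim_inl, Sum.elim_inr] <;> positivity
  set T := Matrix.toLin' (shear x G f) with hT
  set Q : Set (Unit ⊕ (Fin m ⊕ Unit) → ℝ) := T '' Set.Icc (-r) r with hQ
  have hQc : IsCompact Q := isCompact_Icc.image (LinearMap.continuous_of_finiteDimensional T)
  have hvol : volume Q = ENNReal.ofReal ((2 * κ) ^ (m + 2) / (B * R ^ m * δ)) := by
    rw [hQ, Measure.addHaar_image_linearMap, hT, LinearMap.det_toLin', det_shear, Real.volume_Icc_pi,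
      ← ENNReal.ofReal_prod_of_nonneg]
    · rw [abs_one, ENNReal.ofReal_one, one_mul]
      congr 1
      simp only [Pi.neg_apply, sub_neg_eq_add, Fintype.prod_sum_type, r, Sum.elim_inl,
        Sum.elim_inr, Finset.prod_const, Finset.card_univ, Fintype.card_fin,
        Finset.univ_unique, Finset.card_singleton, pow_one]
      rw [← two_mul, ← two_mul, ← two_mul, mul_pow, div_pow]
      field_simp
      ring
    · intro i _
      have := hr i
      simp only [Pi.neg_apply]; linarith
  let tv : (ℤ × (Fin m → ℤ) × ℤ) → (Unit ⊕ (Fin m ⊕ Unit) → ℤ) := fun p =>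
    Sum.elim (fun _ => p.1) (Sum.elim p.2.1 fun _ => p.2.2)
  have htv : Function.Injective tv := by
    intro p p' h
    have h1 := congrFun h (.inl ())
    have h2 := fun i => congrFun h (.inr (.inl i))
    have h3 := congrFun h (.inr (.inr ()))
    simp only [tv, Sum.elim_inl, Sum.elim_inr] at h1 h2 h3
    exact Prod.ext h1 (Prod.ext (funext h2) h3)
  let fv : (Unit ⊕ (Fin m ⊕ Unit) → ℤ) → (ℤ × (Fin m → ℤ) × ℤ) := fun h =>
    (h (.inl ()), fun i => h (.inr (.inl i)), h (.inr (.inr ())))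
  have hfv : Function.Injective fv := by
    intro p p' h
    simp only [fv, Prod.mk.injEq] at h
    funext i
    rcases i with i | i | i
    · exact h.1
    · exact congrFun h.2.1 i
    · exact h.2.2
  obtain ⟨M, hM⟩ := hQc.isBounded.exists_norm_le
  let H' : Finset (Unit ⊕ (Fin m ⊕ Unit) → ℤ) :=
    (Finset.Icc (fun _ => -⌈2 * M⌉) (fun _ => ⌈2 * M⌉)).filter
      fun h => ∃ α ∈ Q, ∃ β ∈ Q, ∀ i, (h i : ℝ) = α i - β i
  have hmemH : ∀ h : Unit ⊕ (Fin m ⊕ Unit) → ℤ, ∀ α ∈ Q, ∀ β ∈ Q,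
      (∀ i, (h i : ℝ) = α i - β i) → h ∈ H' := by
    intro h α hα β hβ hh
    refine Finset.mem_filter.mpr ⟨Finset.mem_Icc.mpr ?_, α, hα, β, hβ, hh⟩
    have key : ∀ i, |(h i : ℝ)| ≤ 2 * M := by
      intro i
      rw [hh i]
      have h1 := (norm_le_pi_norm α i).trans (hM α hα)
      have h2 := (norm_le_pi_norm β i).trans (hM β hβ)
      rw [Real.norm_eq_abs] at h1 h2
      linarith [abs_sub (α i) (β i)]
    refine ⟨fun i => ?_, fun i => ?_⟩
    · have h1 := (abs_le.mp (key i)).1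
      have h2 := Int.le_ceil (2 * M)
      have : (-⌈2 * M⌉ : ℝ) ≤ h i := by linarith
      exact_mod_cast this
    · have h1 := (abs_le.mp (key i)).2
      have h2 := Int.le_ceil (2 * M)
      have : (h i : ℝ) ≤ ⌈2 * M⌉ := by linarith
      exact_mod_cast this
  have hmain := card_mul_volume_le hQc.isClosed.measurableSet (S.image tv) H' ?_ hmemH
  · refine ⟨H'.image fv, ?_, ?_⟩
    · intro h hh
      obtain ⟨k, hk, rfl⟩ := Finset.mem_image.mp hh
      obtain ⟨-, _, ⟨α, hα, rfl⟩, _, ⟨β, hβ, rfl⟩, hd⟩ := Finset.mem_filter.mp hk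
      have h1 := hd (.inl ())
      have h2 := fun i => hd (.inr (.inl i))
      have h3 := hd (.inr (.inr ()))
      simp only [hT, Matrix.toLin'_apply, shear_mulVec_last, shear_mulVec_mid,
        shear_mulVec_first] at h1 h2 h3
      have hdiff : ∀ i, |α i - β i| ≤ 2 * r i := by
        intro i
        have a1 := hα.1 i
        have a2 := hα.2 i
        have b1 := hβ.1 i
        have b2 := hβ.2 i
        simp only [Pi.neg_apply] at a1 b1
        rw [abs_le]; constructor <;> linarith
      have hb : ∀ t : ℝ, 0 < t → 2 * (κ / t) ≤ 1 / (2 * t) := by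
        intro t ht
        rw [← mul_div_assoc, div_le_div_iff₀ ht (by positivity)]
        nlinarith
      simp only [fv]
      refine ⟨?_, fun i => ?_, ?_⟩
      · have : (k (.inl ()) : ℝ) + ∑ i, (k (.inr (.inl i)) : ℝ) * x i + k (.inr (.inr ())) * f
            = α (.inl ()) - β (.inl ()) := by
          rw [h1, h3]
          simp only [h2, sub_mul, Finset.sum_sub_distrib, Finset.sum_mul]
          have e1 : ∀ γ : Unit ⊕ (Fin m ⊕ Unit) → ℝ, ∑ i, G i * γ (.inr (.inr ())) * x i =
            ∑ i, G i * x i * γ (.inr (.inr ())) := fun γ =>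
              Finset.sum_congr rfl fun i _ => by ring
          have e2 : ∀ γ : Unit ⊕ (Fin m ⊕ Unit) → ℝ, ∑ i, γ (.inr (.inl i)) * x i =
            ∑ i, x i * γ (.inr (.inl i)) := fun γ =>
              Finset.sum_congr rfl fun i _ => by ring
          rw [e1, e1, e2, e2]
          ring
        rw [this]
        exact (hdiff _).trans (hb B hB)
      · have : (k (.inr (.inl i)) : ℝ) + k (.inr (.inr ())) * G i
            = α (.inr (.inl i)) - β (.inr (.inl i)) := by
          rw [h2, h3]; ring
        rw [this]
        exact (hdiff _).trans (hb R hR)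
      · rw [h3]
        exact (hdiff _).trans (hb δ hδ)
    · rw [Finset.card_image_of_injective _ hfv]
      rw [Finset.card_image_of_injective _ htv, hvol] at hmain
      have hD : (0 : ℝ) < B * R ^ m * δ := by positivity
      have h5 : (S.card : ℝ) * ((2 * κ) ^ (m + 2) / (B * R ^ m * δ)) ≤ 4 * H'.card := by
        have := ENNReal.toReal_mono (by
          exact ENNReal.mul_ne_top (by norm_num) (ENNReal.natCast_ne_top _)) hmain
        rw [ENNReal.toReal_mul, ENNReal.toReal_mul, ENNReal.toReal_ofReal (by positivity)] at this
        simpa using this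
      rw [← mul_div_assoc, div_le_iff₀ hD] at h5
      rw [div_mul_eq_mul_div, div_mul_eq_mul_div, le_div_iff₀ (by positivity)]
      linarith
  · intro p hp α hα
    obtain ⟨s, hs, rfl⟩ := Finset.mem_image.mp hp
    obtain ⟨β, hβ, rfl⟩ := hα
    obtain ⟨h1, h2, h3⟩ := hS s hs
    have hβr : ∀ i, |β i| ≤ r i := fun i => abs_le.mpr ⟨hβ.1 i, hβ.2 i⟩
    have hexp : ∑ i, (tv s i : ℝ) * T β i = s.1 * β (.inl ()) +
        ∑ i, ((s.2.1 i : ℝ) - s.1 * x i) * β (.inr (.inl i)) +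
        ((s.2.2 : ℝ) - s.1 * f - ∑ i, G i * (s.2.1 i - s.1 * x i)) * β (.inr (.inr ())) := by
      simp only [Fintype.sum_sum_type, tv, Sum.elim_inl, Sum.elim_inr, hT, Matrix.toLin'_apply,
        Finset.univ_unique, Finset.sum_singleton]
      simp only [PUnit.default_eq_unit, shear_mulVec_last, shear_mulVec_mid, shear_mulVec_first]
      simp only [mul_sub, sub_mul, mul_add, Finset.sum_sub_distrib, Finset.mul_sum,
        Finset.sum_mul]
      have e1 : ∑ i, (s.1 : ℝ) * (G i * x i * β (.inr (.inr ()))) =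
        ∑ i, G i * (s.1 * x i) * β (.inr (.inr ())) := Finset.sum_congr rfl fun i _ => by ring
      have e2 : ∑ i, (s.1 : ℝ) * (x i * β (.inr (.inl i))) =
        ∑ i, s.1 * x i * β (.inr (.inl i)) := Finset.sum_congr rfl fun i _ => by ring
      have e3 : ∑ i, (s.2.1 i : ℝ) * (G i * β (.inr (.inr ()))) =
        ∑ i, G i * s.2.1 i * β (.inr (.inr ())) := Finset.sum_congr rfl fun i _ => by ring
      rw [e1, e2, e3]
      ring
    rw [hexp]
    have b1 : |(s.1 : ℝ) * β (.inl ())| ≤ 2 * κ := by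
      rw [abs_mul]
      calc |(s.1 : ℝ)| * |β (.inl ())| ≤ 2 * B * (κ / B) :=
            mul_le_mul h1 (hβr _) (abs_nonneg _) (by positivity)
        _ = 2 * κ := by field_simp
    have b2 : |∑ i, ((s.2.1 i : ℝ) - s.1 * x i) * β (.inr (.inl i))| ≤ m * κ := by
      calc _ ≤ ∑ i, |((s.2.1 i : ℝ) - s.1 * x i) * β (.inr (.inl i))| :=
            Finset.abs_sum_le_sum_abs _ _
        _ ≤ ∑ _i : Fin m, κ := by
            refine Finset.sum_le_sum fun i _ => ?_
            rw [abs_mul]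
            calc _ ≤ R * (κ / R) := mul_le_mul (h2 i) (hβr _) (abs_nonneg _) hR.le
              _ = κ := by field_simp
        _ = m * κ := by simp
    have b3 : |((s.2.2 : ℝ) - s.1 * f - ∑ i, G i * (s.2.1 i - s.1 * x i)) *
        β (.inr (.inr ()))| ≤ κ := by
      rw [abs_mul]
      calc _ ≤ δ * (κ / δ) := mul_le_mul h3 (hβr _) (abs_nonneg _) hδ.le
        _ = κ := by field_simp
    calc _ ≤ _ := abs_add_three _ _ _
      _ ≤ 2 * κ + m * κ + κ := by gcongr
      _ = 1 / 8 := by rw [← hκ1]; ring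

/-- A function with uniformly Lipschitz invertible gradient `G`, quadratic Taylor remainder and
strong convexity or concavity along an integer direction, together with its Legendre dual. -/
structure HalfPair {m : ℕ} (L c : ℝ) (f fs : (Fin m → ℝ) → ℝ)
    (G Gs : (Fin m → ℝ) → (Fin m → ℝ)) : Prop where
  inv : ∀ x, Gs (G x) = x
  legendre : ∀ x, f x + fs (G x) = ∑ i, G x i * x i
  lip : ∀ x x', ‖G x - G x'‖ ≤ L * ‖x - x'‖
  taylor : ∀ x x', |f x' - f x - ∑ i, G x i * (x' i - x i)| ≤ L * ‖x' - x‖ ^ 2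
  conv : ∃ (σ : ℝ) (e : Fin m → ℤ), |σ| ≤ 1 ∧ (∀ i, |(e i : ℝ)| ≤ 1) ∧ ∀ (x : Fin m → ℝ) (t : ℝ),
    c * t ^ 2 ≤ σ * (f (fun i => x i + t * e i) - f x - t * ∑ i, G x i * e i)

/-- Two functions forming a `HalfPair` in both orders. -/
def DualPair {m : ℕ} (L c : ℝ) (f fs : (Fin m → ℝ) → ℝ)
    (G Gs : (Fin m → ℝ) → (Fin m → ℝ)) : Prop :=
  HalfPair L c f fs G Gs ∧ HalfPair L c fs f Gs G

/-- The triple `p = (q, a, b)` has `B ≤ q < 2 * B`, `a / q` is within `1` of `z`, and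
`b / q` is very close to `f (a / q)`. -/
def Near {m : ℕ} (f : (Fin m → ℝ) → ℝ) (B : ℝ) (z : Fin m → ℝ) (p : ℤ × (Fin m → ℤ) × ℤ) : Prop :=
  (B ≤ p.1 ∧ (p.1 : ℝ) < 2 * B) ∧ (∀ i, |(p.2.1 i : ℝ) / p.1 - z i| ≤ 1) ∧
    |(p.2.2 : ℝ) - p.1 * f (fun i => p.2.1 i / p.1)| ≤ 1 / B

lemma exists_lt_lt_of_two_lt_card {α : Type*} [LinearOrder α] {S : Finset α} (h : 2 < S.card) :
    ∃ a ∈ S, ∃ b ∈ S, ∃ d ∈ S, a < b ∧ b < d := by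
  obtain ⟨a, ha, b, hb, d, hd, hab, had, hbd⟩ := Finset.two_lt_card.mp h
  rcases lt_or_gt_of_ne hab with h1 | h1 <;> rcases lt_or_gt_of_ne had with h2 | h2 <;>
    rcases lt_or_gt_of_ne hbd with h3 | h3
  · exact ⟨a, ha, b, hb, d, hd, h1, h3⟩
  · exact ⟨a, ha, d, hd, b, hb, h2, h3⟩
  · exact absurd (h3.trans h2) (lt_asymm h1)
  · exact ⟨d, hd, a, ha, b, hb, h2, h1⟩
  · exact ⟨b, hb, a, ha, d, hd, h1, h2⟩
  · exact absurd (h2.trans h3) (lt_asymm h1)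
  · exact ⟨b, hb, d, hd, a, ha, h3, h2⟩
  · exact ⟨d, hd, b, hb, a, ha, h3, h1⟩

lemma card_le_of_dist_le {m : ℕ} (X : Finset (Fin m → ℤ)) (w : Fin m → ℝ) {r : ℝ} (hr : 0 ≤ r)
    (hX : ∀ k ∈ X, ∀ i, |(k i : ℝ) - w i| ≤ r) : (X.card : ℝ) ≤ (2 * r + 1) ^ m := by
  classical
  have hsub : X ⊆ Fintype.piFinset fun i => Finset.Icc ⌈w i - r⌉ ⌊w i + r⌋ := by
    intro k hk
    rw [Fintype.mem_piFinset]
    intro i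
    have := abs_le.mp (hX k hk i)
    exact Finset.mem_Icc.mpr ⟨Int.ceil_le.mpr (by linarith), Int.le_floor.mpr (by linarith)⟩
  calc (X.card : ℝ) ≤ ((Fintype.piFinset fun i => Finset.Icc ⌈w i - r⌉ ⌊w i + r⌋).card : ℝ) := by
        exact_mod_cast Finset.card_le_card hsub
    _ = ∏ i, ((Finset.Icc ⌈w i - r⌉ ⌊w i + r⌋).card : ℝ) := by
        rw [Fintype.card_piFinset]; push_cast; rfl
    _ ≤ ∏ _i : Fin m, (2 * r + 1) := by
        refine Finset.prod_le_prod (fun i _ => by positivity) fun i _ => ?_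
        rw [Int.card_Icc]
        have h1 := Int.floor_le (w i + r)
        have h2 := Int.le_ceil (w i - r)
        have h3 : (((⌊w i + r⌋ + 1 - ⌈w i - r⌉).toNat : ℤ) : ℝ) ≤ 2 * r + 1 := by
          rw [Int.toNat_eq_max]
          push_cast
          exact max_le (by linarith) (by linarith)
        exact_mod_cast h3
    _ = (2 * r + 1) ^ m := by simp

lemma near_cover {m : ℕ} {f : (Fin m → ℝ) → ℝ} {J A D : ℝ} (hD : 0 ≤ D)
    (hA : ∀ (z : Fin m → ℝ) (T : Finset (ℤ × (Fin m → ℤ) × ℤ)),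
      (∀ p ∈ T, Near f J z p) → (T.card : ℝ) ≤ A)
    (w : Fin m → ℝ) (T : Finset (ℤ × (Fin m → ℤ) × ℤ))
    (hT : ∀ p ∈ T, (J ≤ p.1 ∧ (p.1 : ℝ) < 2 * J) ∧ (∀ i, |(p.2.1 i : ℝ) / p.1 - w i| ≤ D) ∧
      |(p.2.2 : ℝ) - p.1 * f (fun i => p.2.1 i / p.1)| ≤ 1 / J) :
    (T.card : ℝ) ≤ (2 * D + 3) ^ m * A := by
  classical
  let F : (ℤ × (Fin m → ℤ) × ℤ) → (Fin m → ℤ) := fun p i => round ((p.2.1 i : ℝ) / p.1 - w i)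
  have hfib : ∀ k ∈ T.image F, ((T.filter fun p => F p = k).card : ℝ) ≤ A := by
    intro k _
    refine hA (fun i => w i + k i) _ fun p hp => ?_
    obtain ⟨hpT, rfl⟩ := Finset.mem_filter.mp hp
    obtain ⟨h1, h2, h3⟩ := hT p hpT
    refine ⟨h1, fun i => ?_, h3⟩
    have := abs_sub_round ((p.2.1 i : ℝ) / p.1 - w i)
    calc _ = |(p.2.1 i : ℝ) / p.1 - w i - round ((p.2.1 i : ℝ) / p.1 - w i)| := by
          congr 1; simp only [F]; ring
      _ ≤ 1 := by linarith
  have himg : ((T.image F).card : ℝ) ≤ (2 * D + 3) ^ m := by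
    have := card_le_of_dist_le (T.image F) (fun _ => 0) (r := D + 1) (by linarith) ?_
    · convert this using 2; ring
    · intro k hk i
      obtain ⟨p, hp, rfl⟩ := Finset.mem_image.mp hk
      have h1 := abs_sub_round ((p.2.1 i : ℝ) / p.1 - w i)
      have h2 := (hT p hp).2.1 i
      simp only [F, sub_zero]
      rw [abs_le] at *
      constructor <;> linarith
  have hA0 : 0 ≤ A := by simpa using hA 0 ∅ (by simp)
  calc (T.card : ℝ) = ∑ k ∈ T.image F, ((T.filter fun p => F p = k).card : ℝ) := by
        exact_mod_cast Finset.card_eq_sum_card_image F T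
    _ ≤ ∑ _k ∈ T.image F, A := Finset.sum_le_sum hfib
    _ = (T.image F).card * A := by simp
    _ ≤ _ := by gcongr

section HalfPair
variable {m : ℕ} {L c : ℝ} {f fs : (Fin m → ℝ) → ℝ} {G Gs : (Fin m → ℝ) → (Fin m → ℝ)}

lemma three_points {σ : ℝ} {e : Fin m → ℤ} (hσ : |σ| ≤ 1)
    (hconv : ∀ (x : Fin m → ℝ) (t : ℝ),
      c * t ^ 2 ≤ σ * (f (fun i => x i + t * e i) - f x - t * ∑ i, G x i * e i))
    (x : Fin m → ℝ) {s t : ℝ} (hs : 0 < s) (ht : 0 < t) (h0 : ℝ) (h' : Fin m → ℝ) {j η : ℝ}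
    (hj : 0 < j)
    (e1 : |h0 + ∑ i, h' i * (x i + (-s) * e i) + j * f (fun i => x i + (-s) * e i)| ≤ η)
    (e2 : |h0 + ∑ i, h' i * x i + j * f x| ≤ η)
    (e3 : |h0 + ∑ i, h' i * (x i + t * e i) + j * f (fun i => x i + t * e i)| ≤ η) :
    j * (c * (s * t)) ≤ 2 * η := by
  have c1 := hconv x (-s)
  have c2 := hconv x t
  set g := ∑ i, G x i * e i
  set f1 := f (fun i => x i + (-s) * e i)
  set f3 := f (fun i => x i + t * e i)
  set k := ∑ i, h' i * e i with hk
  have s1 : ∀ u : ℝ, ∑ i, h' i * (x i + u * e i) = ∑ i, h' i * x i + u * k := by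
    intro u
    rw [hk, Finset.mul_sum, ← Finset.sum_add_distrib]
    exact Finset.sum_congr rfl fun i _ => by ring
  rw [s1] at e1 e3
  set a := h0 + ∑ i, h' i * x i
  have hsum : c * (t * s ^ 2 + s * t ^ 2) ≤ σ * (t * f1 + s * f3 - (s + t) * f x) := by
    nlinarith
  have hφ : j * (t * f1 + s * f3 - (s + t) * f x) =
      t * (h0 + (∑ i, h' i * x i + -s * k) + j * f1) +
      s * (h0 + (∑ i, h' i * x i + t * k) + j * f3) - (s + t) * (a + j * f x) := by
    simp only [a]; ring
  have hbd : |j * (t * f1 + s * f3 - (s + t) * f x)| ≤ 2 * η * (s + t) := by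
    rw [hφ]
    rw [abs_le] at *
    constructor <;> nlinarith
  have h1 : j * (c * (t * s ^ 2 + s * t ^ 2)) ≤ 2 * η * (s + t) := by
    calc j * (c * (t * s ^ 2 + s * t ^ 2)) ≤ j * (σ * (t * f1 + s * f3 - (s + t) * f x)) := by gcongr
      _ = σ * (j * (t * f1 + s * f3 - (s + t) * f x)) := by ring
      _ ≤ |σ| * |j * (t * f1 + s * f3 - (s + t) * f x)| := by
          rw [← abs_mul]; exact le_abs_self _
      _ ≤ 1 * |j * (t * f1 + s * f3 - (s + t) * f x)| := by gcongr
      _ ≤ _ := by linarith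
  have hst : 0 < s + t := by positivity
  refine le_of_mul_le_mul_right ?_ hst
  calc j * (c * (s * t)) * (s + t) = j * (c * (t * s ^ 2 + s * t ^ 2)) := by ring
    _ ≤ _ := h1

/-- Few grid points of a ball lie in a thin neighbourhood of the zero set of a function
that is strongly convex in one direction. -/
lemma card_thin_le (hf : HalfPair L c f fs G Gs) {ρ : ℝ} (hρ : 0 < ρ) (hc : 0 < c) (h0 : ℝ)
    (h' : Fin m → ℝ) {j η : ℝ} (hj : 0 < j) (M τ : ℕ) (hτ : 0 < τ)
    (hη : 2 * η < j * (c * (τ * ρ) ^ 2)) (X : Finset (Fin m → ℤ)) (w : Fin m → ℝ) {r : ℝ} (hr : 0 ≤ r)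
    (hX : ∀ k ∈ X, ∀ i, |(k i : ℝ) - w i| ≤ r)
    (hthin : ∀ k ∈ X, |h0 + ∑ i, h' i * (ρ * k i) + j * f (fun i => ρ * k i)| ≤ η) :
    (M + 1 : ℝ) * X.card ≤ 2 * (2 * (r + M * τ) + 1) ^ m := by
  classical
  obtain ⟨σ, e, hσ, he, hconv⟩ := hf.conv
  let F : (Fin m → ℤ) × ℕ → (Fin m → ℤ) := fun p i => p.1 i + p.2 * τ * e i
  have htwo : ∀ y ∈ (X ×ˢ Finset.range (M + 1)).image F,
      ((X ×ˢ Finset.range (M + 1)).filter fun p => F p = y).card ≤ 2 := by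
    intro y _
    by_contra! hcon
    set Y := (X ×ˢ Finset.range (M + 1)).filter fun p => F p = y with hY
    have hinj : Set.InjOn Prod.snd (Y : Set ((Fin m → ℤ) × ℕ)) := by
      intro p hp p' hp' hpp
      have h1 := (Finset.mem_filter.mp (Finset.mem_coe.mp hp)).2
      have h2 := (Finset.mem_filter.mp (Finset.mem_coe.mp hp')).2
      refine Prod.ext (funext fun i => ?_) hpp
      have := congrFun (h1.trans h2.symm) i
      simp only [F, hpp] at this
      linarith
    have hcard : 2 < (Y.image Prod.snd).card := by rwa [Finset.card_image_of_injOn hinj]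
    obtain ⟨a, ha, b, hb, d, hd, hab, hbd⟩ := exists_lt_lt_of_two_lt_card hcard
    have hval : ∀ a ∈ Y.image Prod.snd, ∃ k ∈ X, ∀ i, (k i : ℝ) = y i - a * τ * e i := by
      intro a ha
      obtain ⟨p, hp, rfl⟩ := Finset.mem_image.mp ha
      obtain ⟨h1, h2⟩ := Finset.mem_filter.mp hp
      refine ⟨p.1, (Finset.mem_product.mp h1).1, fun i => ?_⟩
      rw [← h2]; simp only [F]; push_cast; ring
    obtain ⟨ka, hka, ea⟩ := hval a ha
    obtain ⟨kb, hkb, eb⟩ := hval b hb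
    obtain ⟨kd, hkd, ed⟩ := hval d hd
    have ta := hthin ka hka
    have tb := hthin kb hkb
    have td := hthin kd hkd
    have hab' : (a : ℝ) + 1 ≤ b := by exact_mod_cast hab
    have hbd' : (b : ℝ) + 1 ≤ d := by exact_mod_cast hbd
    have hτ' : (0 : ℝ) < τ := by exact_mod_cast hτ
    have q1 : ∀ i, ρ * (ka i : ℝ) = ρ * kb i + (b - a) * (τ * ρ) * e i := by
      intro i; rw [ea, eb]; ring
    have q2 : ∀ i, ρ * (kd i : ℝ) = ρ * kb i + (-((d - b) * (τ * ρ))) * e i := by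
      intro i; rw [ed, eb]; ring
    simp only [q1] at ta
    simp only [q2] at td
    have hτρ : 0 < τ * ρ := by positivity
    have := three_points hσ hconv (fun i => ρ * kb i)
      (s := (d - b) * (τ * ρ)) (t := (b - a) * (τ * ρ))
      (mul_pos (by linarith) hτρ) (mul_pos (by linarith) hτρ) h0 h' hj td tb ta
    have h1 : (τ * ρ) ^ 2 ≤ (d - b) * (τ * ρ) * ((b - a) * (τ * ρ)) := by
      have : 1 ≤ (d - b : ℝ) * (b - a) := by nlinarith
      nlinarith [sq_nonneg (τ * ρ)]
    have h2 : j * (c * (τ * ρ) ^ 2) ≤ j * (c * ((d - b) * (τ * ρ) * ((b - a) * (τ * ρ)))) := by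
      gcongr
    linarith
  have hle := Finset.card_le_mul_card_image (f := F) (X ×ˢ Finset.range (M + 1)) 2 htwo
  have himg := card_le_of_dist_le ((X ×ˢ Finset.range (M + 1)).image F) w (r := r + M * τ)
    (by positivity) ?_
  · rw [Finset.card_product, Finset.card_range] at hle
    have hle' : (X.card : ℝ) * (M + 1) ≤ 2 * ((X ×ˢ Finset.range (M + 1)).image F).card := by
      exact_mod_cast hle
    linarith
  · intro k hk i
    obtain ⟨p, hp, rfl⟩ := Finset.mem_image.mp hk
    obtain ⟨h1, h2⟩ := Finset.mem_product.mp hp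
    have h3 : (p.2 : ℝ) ≤ M := by
      exact_mod_cast Nat.lt_succ_iff.mp (Finset.mem_range.mp h2)
    have h4 : |(p.2 : ℝ) * τ * e i| ≤ M * τ := by
      rw [abs_mul, abs_of_nonneg (by positivity : (0 : ℝ) ≤ p.2 * τ)]
      calc (p.2 : ℝ) * τ * |(e i : ℝ)| ≤ M * τ * 1 := by gcongr; exact he i
        _ = _ := by ring
    have h5 := hX p.1 h1 i
    simp only [F]
    push_cast
    calc |(p.1 i : ℝ) + p.2 * τ * e i - w i| = |((p.1 i : ℝ) - w i) + p.2 * τ * e i| := by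
          congr 1; ring
      _ ≤ _ := abs_add_le _ _
      _ ≤ _ := add_le_add h5 h4

/-- An integer point of the polar body at `x` is close to the dual hypersurface. -/
lemma dual_point (hf : DualPair L c f fs G Gs) (hL : 0 ≤ L) {h0 : ℝ} {h' : Fin m → ℝ} {j : ℝ}
    (hj : 0 < j) {x : Fin m → ℝ} {η R : ℝ} (hR : 0 < R)
    (hx : |h0 + ∑ i, h' i * x i + j * f x| ≤ η) (hg : ∀ i, |h' i + j * G x i| ≤ 1 / (2 * R)) :
    ‖(fun i => -h' i / j) - G x‖ ≤ 1 / (2 * R * j) ∧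
    ‖Gs (fun i => -h' i / j) - x‖ ≤ L / (2 * R * j) ∧
    |h0 - j * fs (fun i => -h' i / j)| ≤ η + L ^ 3 / (4 * R ^ 2 * j) := by
  set y : Fin m → ℝ := fun i => -h' i / j with hy
  have h1 : ‖y - G x‖ ≤ 1 / (2 * R * j) := by
    rw [pi_norm_le_iff_of_nonneg (by positivity)]
    intro i
    have : (y - G x) i = -(h' i + j * G x i) / j := by simp only [hy, Pi.sub_apply]; field_simp; ring
    rw [this, Real.norm_eq_abs, abs_div, abs_neg, abs_of_pos hj, div_le_iff₀ hj]
    calc _ ≤ _ := hg i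
      _ = _ := by field_simp
  have h2 : ‖Gs y - x‖ ≤ L / (2 * R * j) := by
    have := hf.2.lip y (G x)
    rw [hf.1.inv] at this
    calc _ ≤ _ := this
      _ ≤ L * (1 / (2 * R * j)) := by gcongr
      _ = _ := by ring
  refine ⟨h1, h2, ?_⟩
  have h3 := hf.1.taylor (Gs y) x
  have h4 := hf.2.legendre y
  rw [hf.2.inv] at h3
  have h5 : h0 - j * fs y = (h0 + ∑ i, h' i * x i + j * f x) -
      j * (f x - f (Gs y) - ∑ i, y i * (x i - Gs y i)) := by
    have e1 : ∑ i, h' i * x i = - (j * ∑ i, y i * x i) := by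
      rw [Finset.mul_sum, ← Finset.sum_neg_distrib]
      refine Finset.sum_congr rfl fun i _ => ?_
      simp only [hy]; field_simp
    have e2 : ∑ i, y i * (x i - Gs y i) = ∑ i, y i * x i - ∑ i, Gs y i * y i := by
      rw [← Finset.sum_sub_distrib]
      exact Finset.sum_congr rfl fun i _ => by ring
    rw [e1, e2, ← h4]; ring
  rw [h5]
  have h6 : |j * (f x - f (Gs y) - ∑ i, y i * (x i - Gs y i))| ≤ L ^ 3 / (4 * R ^ 2 * j) := by
    rw [abs_mul, abs_of_pos hj]
    have : ‖x - Gs y‖ ≤ L / (2 * R * j) := by rwa [norm_sub_rev]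
    calc _ ≤ j * (L * ‖x - Gs y‖ ^ 2) := by gcongr
      _ ≤ j * (L * (L / (2 * R * j)) ^ 2) := by gcongr
      _ = _ := by field_simp; norm_num
  exact (abs_sub _ _).trans (add_le_add hx h6)

end HalfPair

/-- The grid point `k` at scale `ρ` and the integer vector `h` pair up: `h` lies in the polar body
of the cap of the graph of `f` around `ρ * k`. -/
def PolarAt {m : ℕ} (f : (Fin m → ℝ) → ℝ) (G : (Fin m → ℝ) → (Fin m → ℝ)) (B R ρ : ℝ)
    (k : Fin m → ℤ) (h : ℤ × (Fin m → ℤ) × ℤ) : Prop :=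
  |(h.1 : ℝ) + ∑ i, h.2.1 i * (ρ * k i) + h.2.2 * f (fun i => ρ * k i)| ≤ 1 / (2 * B) ∧
    ∀ i, |(h.2.1 i : ℝ) + h.2.2 * G (fun i => ρ * k i) i| ≤ 1 / (2 * R)

lemma PolarAt.neg {m : ℕ} {f : (Fin m → ℝ) → ℝ} {G : (Fin m → ℝ) → (Fin m → ℝ)} {B R ρ : ℝ}
    {k : Fin m → ℤ} {h : ℤ × (Fin m → ℤ) × ℤ} (H : PolarAt f G B R ρ k h) :
    PolarAt f G B R ρ k (-h) := by
  obtain ⟨h1, h2⟩ := H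
  refine ⟨?_, fun i => ?_⟩
  · rw [← abs_neg]
    convert h1 using 2
    simp [Finset.sum_neg_distrib]
    ring
  · rw [← abs_neg]
    convert h2 i using 2
    simp
    ring

lemma card_polar_level_le (m : ℕ) {L c : ℝ} (hL : 1 ≤ L) (hc : 0 < c) :
    ∃ C ≥ (1 : ℝ), ∀ (f fs : (Fin m → ℝ) → ℝ) (G Gs : (Fin m → ℝ) → (Fin m → ℝ)),
      DualPair L c f fs G Gs → ∀ R B J A : ℝ, 1 ≤ R → L ^ 3 ≤ R ^ 2 → 1 ≤ J → R ^ 2 * J ≤ B →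
      (∀ (z : Fin m → ℝ) (T : Finset (ℤ × (Fin m → ℤ) × ℤ)),
        (∀ p ∈ T, Near fs J z p) → (T.card : ℝ) ≤ A) →
      ∀ (z : Fin m → ℝ) (Y : Finset ((Fin m → ℤ) × (ℤ × (Fin m → ℤ) × ℤ))),
      (∀ y ∈ Y, PolarAt f G B R (R / (2 * L * B)) y.1 y.2 ∧ (J ≤ y.2.2.2 ∧ (y.2.2.2 : ℝ) < 2 * J) ∧
        ∀ i, |R / (2 * L * B) * y.1 i - z i| ≤ 2) →
      (Y.card : ℝ) ≤ C * A * (B / (R ^ 2 * J)) ^ m / √(B / (R ^ 2 * J)) := by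
  classical
  set a : ℝ := 2 * L / √c with ha
  have hL0 : 0 < L := by linarith
  have hsc : 0 < √c := Real.sqrt_pos.mpr hc
  have ha0 : 0 < a := by positivity
  set C1 : ℝ := 2 * L ^ 2 + 2 * (a + 1) + 1 with hC1
  set D : ℝ := 1 + 2 * L with hD
  have hC11 : 1 ≤ C1 := by nlinarith [sq_nonneg L]
  refine ⟨(2 * D + 3) ^ m * (2 * C1 ^ m), ?_, ?_⟩
  · have h1 : 1 ≤ (2 * D + 3) ^ m := one_le_pow₀ (by linarith)
    have h2 : 1 ≤ C1 ^ m := one_le_pow₀ hC11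
    nlinarith
  intro f fs G Gs hf R B J A hR hLR hJ hB hA z Y hY
  have hR0 : 0 < R := by linarith
  have hJ0 : 0 < J := by linarith
  have hB0 : 0 < B := lt_of_lt_of_le (by positivity) hB
  set ρ := R / (2 * L * B) with hρ
  have hρ0 : 0 < ρ := by positivity
  set Λ := B / (R ^ 2 * J) with hΛ
  have hΛ1 : 1 ≤ Λ := by rw [hΛ, le_div_iff₀ (by positivity)]; linarith
  set l := √Λ with hl
  have hll : l * l = Λ := Real.mul_self_sqrt (by linarith)
  have hl1 : 1 ≤ l := by rw [hl]; exact Real.one_le_sqrt.mpr hΛ1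
  have hA0 : 0 ≤ A := by simpa using hA 0 ∅ (by simp)
  have hfib : ∀ h ∈ Y.image Prod.snd, ((Y.filter fun y => y.2 = h).card : ℝ) ≤
      2 * C1 ^ m * Λ ^ m / l := by
    intro h hh
    obtain ⟨y0, hy0, rfl⟩ := Finset.mem_image.mp hh
    set h := y0.2
    obtain ⟨-, ⟨hj1, hj2⟩, -⟩ := hY y0 hy0
    have hj0 : 0 < (h.2.2 : ℝ) := by linarith
    set X := (Y.filter fun y => y.2 = h).image Prod.fst with hX
    have hXc : (Y.filter fun y => y.2 = h).card = X.card := by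
      rw [hX, Finset.card_image_of_injOn]
      intro p hp p' hp' hpp
      have h1 := (Finset.mem_filter.mp (Finset.mem_coe.mp hp)).2
      have h2 := (Finset.mem_filter.mp (Finset.mem_coe.mp hp')).2
      exact Prod.ext hpp (h1.trans h2.symm)
    have hXm : ∀ k ∈ X, PolarAt f G B R ρ k h := by
      intro k hk
      obtain ⟨p, hp, rfl⟩ := Finset.mem_image.mp hk
      obtain ⟨h1, h2⟩ := Finset.mem_filter.mp hp
      rw [← h2]
      exact (hY p h1).1
    set M := ⌊l⌋₊ with hM
    set τ := ⌊a * l⌋₊ + 1 with hτ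
    have hMl : (M : ℝ) ≤ l := Nat.floor_le (by linarith)
    have hMl' : l ≤ M + 1 := (Nat.lt_floor_add_one l).le
    have hτl : (τ : ℝ) ≤ a * l + 1 := by
      rw [hτ]; push_cast
      linarith [Nat.floor_le (by positivity : 0 ≤ a * l)]
    have hτl' : a * l < τ := by rw [hτ]; push_cast; exact Nat.lt_floor_add_one _
    have key := card_thin_le hf.1 hρ0 hc h.1 (fun i => h.2.1 i) hj0 M τ (Nat.succ_pos _)
      (η := 1 / (2 * B)) ?_ X (fun i => Gs (fun i => -(h.2.1 i : ℝ) / h.2.2) i / ρ)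
      (r := L ^ 2 * Λ) (by positivity) ?_ ?_
    · have hMτ : (M : ℝ) * τ ≤ (a + 1) * Λ := by
        calc (M : ℝ) * τ ≤ l * (a * l + 1) := by gcongr
          _ ≤ l * (a * l + l) := by gcongr
          _ = _ := by rw [← hll]; ring
      have h1 : 2 * (L ^ 2 * Λ + M * τ) + 1 ≤ C1 * Λ := by
        rw [hC1]; nlinarith
      rw [hXc, le_div_iff₀ (by linarith)]
      calc (X.card : ℝ) * l ≤ (M + 1) * X.card := by rw [mul_comm]; gcongr
        _ ≤ _ := key
        _ ≤ 2 * (C1 * Λ) ^ m := by gcongr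
        _ = _ := by rw [mul_pow]; ring
    · have h1 : Λ < τ ^ 2 * c / (4 * L ^ 2) := by
        have h2 : (a * l) ^ 2 < τ ^ 2 := by gcongr
        have h3 : (a * l) ^ 2 = 4 * L ^ 2 / c * Λ := by
          rw [mul_pow, ha, div_pow, Real.sq_sqrt hc.le, ← hll]; ring
        rw [h3] at h2
        rw [lt_div_iff₀ (by positivity)]
        calc Λ * (4 * L ^ 2) = 4 * L ^ 2 / c * Λ * c := by field_simp
          _ < _ := by gcongr
      have h4 : B = Λ * (R ^ 2 * J) := by rw [hΛ]; field_simp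
      calc 2 * (1 / (2 * B)) = Λ * (R ^ 2 * J) / B ^ 2 := by rw [← h4]; field_simp
        _ < (τ ^ 2 * c / (4 * L ^ 2)) * (R ^ 2 * J) / B ^ 2 := by gcongr
        _ = J * (c * (τ * ρ) ^ 2) := by rw [hρ]; field_simp; norm_num
        _ ≤ _ := by gcongr
    · intro k hk i
      have h1 := (dual_point hf hL0.le hj0 hR0 (hXm k hk).1 (hXm k hk).2).2.1
      have h2 := (norm_le_pi_norm _ i).trans h1
      rw [Real.norm_eq_abs, Pi.sub_apply] at h2
      have e : (k i : ℝ) - Gs (fun i => -(h.2.1 i : ℝ) / h.2.2) i / ρ =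
          -(Gs (fun i => -(h.2.1 i : ℝ) / h.2.2) i - ρ * k i) / ρ := by field_simp; ring
      rw [e, abs_div, abs_neg, abs_of_pos hρ0, div_le_iff₀ hρ0]
      calc _ ≤ _ := h2
        _ ≤ L / (2 * R * J) := by gcongr
        _ = L ^ 2 * Λ * ρ := by rw [hρ, hΛ]; field_simp
    · intro k hk
      exact (hXm k hk).1
  have hW : ((Y.image Prod.snd).card : ℝ) ≤ (2 * D + 3) ^ m * A := by
    let F : (ℤ × (Fin m → ℤ) × ℤ) → (ℤ × (Fin m → ℤ) × ℤ) := fun h => (h.2.2, -h.2.1, h.1)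
    have hF : Function.Injective F := by
      rintro ⟨a, b, d⟩ ⟨a', b', d'⟩ h
      simp only [F, Prod.mk.injEq, neg_inj] at h
      simp [h.1, h.2.1, h.2.2]
    rw [← Finset.card_image_of_injective _ hF]
    refine near_cover (J := J) (f := fs) (by positivity) hA (G z) _ fun p hp => ?_
    obtain ⟨h, hh, rfl⟩ := Finset.mem_image.mp hp
    obtain ⟨y, hy, rfl⟩ := Finset.mem_image.mp hh
    obtain ⟨hpol, ⟨hj1, hj2⟩, hz⟩ := hY y hy
    set h := y.2
    have hj0 : 0 < (h.2.2 : ℝ) := by linarith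
    obtain ⟨d1, -, d3⟩ := dual_point hf hL0.le hj0 hR0 hpol.1 hpol.2
    have hneg : (fun i => (((F h).2.1 i : ℤ) : ℝ) / ((F h).1 : ℤ)) =
        fun i => -(h.2.1 i : ℝ) / h.2.2 := by
      funext i; simp [F]
    refine ⟨⟨hj1, hj2⟩, fun i => ?_, ?_⟩
    · rw [congrFun hneg i]
      have h1 := hf.1.lip (fun i => ρ * y.1 i) z
      have h2 : ‖(fun i => ρ * (y.1 i : ℝ)) - z‖ ≤ 2 := by
        rw [pi_norm_le_iff_of_nonneg (by norm_num)]
        exact hz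
      have h3 : ‖(fun i => -(h.2.1 i : ℝ) / h.2.2) - G z‖ ≤ D := by
        calc _ ≤ _ := norm_sub_le_norm_sub_add_norm_sub _ (G (fun i => ρ * y.1 i)) _
          _ ≤ 1 / (2 * R * h.2.2) + L * 2 := add_le_add d1 (h1.trans (by gcongr))
          _ ≤ 1 + L * 2 := by
              gcongr
              rw [div_le_one (by positivity)]
              have : 1 ≤ R * h.2.2 := one_le_mul_of_one_le_of_one_le hR (by linarith)
              linarith
          _ = D := by rw [hD]; ring
      exact (norm_le_pi_norm _ i).trans h3
    · rw [hneg]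
      show |(h.1 : ℝ) - h.2.2 * _| ≤ _
      refine d3.trans ?_
      have hJB : J ≤ B := (le_mul_of_one_le_left hJ0.le (one_le_pow₀ hR)).trans hB
      calc 1 / (2 * B) + L ^ 3 / (4 * R ^ 2 * h.2.2) ≤ 1 / (2 * J) + R ^ 2 / (4 * R ^ 2 * J) := by
            gcongr
        _ = 3 / 4 * (1 / J) := by field_simp; norm_num
        _ ≤ 1 / J := by
            have : 0 < 1 / J := by positivity
            linarith
  calc (Y.card : ℝ) = ∑ h ∈ Y.image Prod.snd, ((Y.filter fun y => y.2 = h).card : ℝ) := by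
        exact_mod_cast Finset.card_eq_sum_card_image Prod.snd Y
    _ ≤ ∑ _h ∈ Y.image Prod.snd, 2 * C1 ^ m * Λ ^ m / l := Finset.sum_le_sum hfib
    _ = (Y.image Prod.snd).card * (2 * C1 ^ m * Λ ^ m / l) := by simp
    _ ≤ ((2 * D + 3) ^ m * A) * (2 * C1 ^ m * Λ ^ m / l) := by gcongr
    _ = _ := by ring

lemma sum_geometric_reflect_le {q : ℝ} (hq0 : 0 ≤ q) (hq : q ≤ 4 / 5) (N : ℕ) :
    ∑ i ∈ Finset.range N, q ^ (N - i) ≤ 4 := by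
  induction N with
  | zero => simp
  | succ N ih =>
    rw [Finset.sum_range_succ]
    have : ∑ i ∈ Finset.range N, q ^ (N + 1 - i) = q * ∑ i ∈ Finset.range N, q ^ (N - i) := by
      rw [Finset.mul_sum]
      refine Finset.sum_congr rfl fun i hi => ?_
      rw [← pow_succ', Nat.succ_sub (Finset.mem_range.mp hi).le]
    rw [this]
    simp only [Nat.add_sub_cancel_left, pow_one]
    nlinarith

lemma card_near_le_of_dual (m : ℕ) {L c : ℝ} (hL : 1 ≤ L) (hc : 0 < c) :
    ∃ C ≥ (1 : ℝ), ∀ (f fs : (Fin m → ℝ) → ℝ) (G Gs : (Fin m → ℝ) → (Fin m → ℝ)),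
      DualPair L c f fs G Gs → ∀ s n : ℕ, 1 ≤ s → L ^ 3 ≤ ((2 : ℝ) ^ s) ^ 2 → ∀ A : ℝ, 0 ≤ A →
      (∀ i, i + 2 * s ≤ n → ∀ (z : Fin m → ℝ) (T : Finset (ℤ × (Fin m → ℤ) × ℤ)),
        (∀ p ∈ T, Near fs (2 ^ i) z p) → (T.card : ℝ) ≤ A * (2 ^ i) ^ m) →
      ∀ (z : Fin m → ℝ) (T : Finset (ℤ × (Fin m → ℤ) × ℤ)), (∀ p ∈ T, Near f (2 ^ n) z p) →
        (T.card : ℝ) ≤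
          (C * (2 ^ s) ^ (m + 2) + C * ((2 ^ s) ^ 2 / (2 ^ s) ^ m) * A) * (2 ^ n) ^ m := by
  classical
  obtain ⟨C0, hC0, hcap⟩ := cap_duality m
  obtain ⟨C1, hC1, hlev⟩ := card_polar_level_le m hL hc
  have hL0 : 0 < L := by linarith
  refine ⟨C0 * (6 * L) ^ m + 8 * C0 * C1 + 1, by
    have : 0 ≤ C0 * (6 * L) ^ m + 8 * C0 * C1 := by positivity
    linarith, ?_⟩
  intro f fs G Gs hf s n hs hLs A hA hrec z T hT
  set R : ℝ := 2 ^ s with hR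
  set B : ℝ := 2 ^ n with hB
  have hR2 : 2 ≤ R := by
    calc (2 : ℝ) = 2 ^ 1 := by norm_num
      _ ≤ _ := pow_le_pow_right₀ (by norm_num) hs
  have hR0 : 0 < R := by linarith
  have hB1 : 1 ≤ B := one_le_pow₀ (by norm_num)
  have hB0 : 0 < B := by linarith
  set ρ := R / (2 * L * B) with hρ
  have hρ0 : 0 < ρ := by positivity
  let F : (ℤ × (Fin m → ℤ) × ℤ) → (Fin m → ℤ) := fun p i => round ((p.2.1 i : ℝ) / p.1 / ρ)
  have hF : ∀ p i, |(p.2.1 i : ℝ) / p.1 - ρ * F p i| ≤ ρ / 2 := by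
    intro p i
    have h1 := abs_sub_round ((p.2.1 i : ℝ) / p.1 / ρ)
    have h2 : (p.2.1 i : ℝ) / p.1 - ρ * F p i =
        ρ * ((p.2.1 i : ℝ) / p.1 / ρ - round ((p.2.1 i : ℝ) / p.1 / ρ)) := by
      simp only [F]; field_simp
    rw [h2, abs_mul, abs_of_pos hρ0]
    nlinarith
  set X := T.image F with hX
  have hH : ∀ k : Fin m → ℤ, ∃ H : Finset (ℤ × (Fin m → ℤ) × ℤ),
      (∀ h ∈ H, PolarAt f G B R ρ k h ∧ |(h.2.2 : ℝ)| ≤ B / (2 * R ^ 2)) ∧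
      ((T.filter fun p => F p = k).card : ℝ) ≤ C0 * R ^ (m + 2) * H.card := by
    intro k
    have hkey := hcap (fun i => ρ * k i) (G fun i => ρ * k i) (f fun i => ρ * k i)
      B R (R ^ 2 / B) hB0 hR0 (by positivity) (T.filter fun p => F p = k) ?_
    · obtain ⟨H, h1, h2⟩ := hkey
      refine ⟨H, fun h hh => ⟨⟨(h1 h hh).1, (h1 h hh).2.1⟩, ?_⟩, ?_⟩
      · refine (h1 h hh).2.2.trans_eq ?_
        field_simp
      · refine h2.trans_eq ?_
        rw [pow_add]
        field_simp
    · intro p hp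
      obtain ⟨hpT, rfl⟩ := Finset.mem_filter.mp hp
      obtain ⟨⟨hq1, hq2⟩, -, hb⟩ := hT p hpT
      have hq0 : 0 < (p.1 : ℝ) := by linarith
      have hqρ : (p.1 : ℝ) * ρ ≤ R := by
        calc (p.1 : ℝ) * ρ ≤ 2 * B * ρ := by gcongr
          _ = R / L := by rw [hρ]; field_simp
          _ ≤ R := div_le_self hR0.le hL
      refine ⟨by rw [abs_of_pos hq0]; exact hq2.le, fun i => ?_, ?_⟩
      · have e : (p.2.1 i : ℝ) - p.1 * (ρ * F p i) = p.1 * ((p.2.1 i : ℝ) / p.1 - ρ * F p i) := by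
          field_simp
        rw [e, abs_mul, abs_of_pos hq0]
        calc _ ≤ (p.1 : ℝ) * (ρ / 2) := by gcongr; exact hF p i
          _ ≤ R := by nlinarith
      · have ht := hf.1.taylor (fun i => ρ * F p i) (fun i => (p.2.1 i : ℝ) / p.1)
        set x : Fin m → ℝ := fun i => ρ * F p i with hx
        set x' : Fin m → ℝ := fun i => (p.2.1 i : ℝ) / p.1 with hx'
        have hn : ‖x' - x‖ ≤ ρ / 2 := by
          rw [pi_norm_le_iff_of_nonneg (by positivity)]
          exact hF p
        have e : (p.2.2 : ℝ) - p.1 * f x - ∑ i, G x i * (p.2.1 i - p.1 * (ρ * F p i)) =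
            (p.2.2 - p.1 * f x') + p.1 * (f x' - f x - ∑ i, G x i * (x' i - x i)) := by
          have : ∑ i, G x i * (p.2.1 i - p.1 * (ρ * F p i)) =
              p.1 * ∑ i, G x i * (x' i - x i) := by
            rw [Finset.mul_sum]
            refine Finset.sum_congr rfl fun i _ => ?_
            simp only [hx, hx']; field_simp
          rw [this]; ring
        rw [e]
        calc _ ≤ _ := abs_add_le _ _
          _ ≤ 1 / B + 2 * B * (L * (ρ / 2) ^ 2) := by
              refine add_le_add hb ?_
              rw [abs_mul, abs_of_pos hq0]
              gcongr
              exact ht.trans (by gcongr)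
          _ = (1 + R ^ 2 / (8 * L)) / B := by rw [hρ]; field_simp; ring
          _ ≤ R ^ 2 / B := by
              gcongr
              have : R ^ 2 / (8 * L) ≤ R ^ 2 / 8 := by gcongr; linarith
              nlinarith
  choose H hH1 hH2 using hH
  have hXz : ∀ k ∈ X, ∀ i, |ρ * k i - z i| ≤ 1 + ρ / 2 := by
    intro k hk i
    obtain ⟨p, hp, rfl⟩ := Finset.mem_image.mp hk
    have h1 := (hT p hp).2.1 i
    have h2 := hF p i
    rw [abs_le] at *
    constructor <;> linarith
  have hXc : (X.card : ℝ) ≤ (6 * L) ^ m * B ^ m := by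
    have := card_le_of_dist_le X (fun i => z i / ρ) (r := 1 / ρ + 1 / 2) (by positivity) ?_
    · rw [← mul_pow]
      refine this.trans (pow_le_pow_left₀ (by positivity) ?_ _)
      have e : 1 / ρ = 2 * L * B / R := by rw [hρ]; field_simp
      have h1 : 2 * L * B / R ≤ 2 * L * B := div_le_self (by positivity) (by linarith)
      have h2 : 1 ≤ L * B := one_le_mul_of_one_le_of_one_le hL hB1
      rw [e]; linarith
    · intro k hk i
      have h1 := hXz k hk i
      have e : (k i : ℝ) - z i / ρ = (ρ * k i - z i) / ρ := by field_simp
      rw [e, abs_div, abs_of_pos hρ0, div_le_iff₀ hρ0]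
      refine h1.trans_eq ?_
      field_simp
  have hpos : ∀ Y : Finset ((Fin m → ℤ) × (ℤ × (Fin m → ℤ) × ℤ)),
      (∀ y ∈ Y, PolarAt f G B R ρ y.1 y.2 ∧ 0 < y.2.2.2 ∧ (y.2.2.2 : ℝ) ≤ B / (2 * R ^ 2) ∧
        y.1 ∈ X) → (Y.card : ℝ) ≤ 4 * C1 * A * (B / R ^ 2) ^ m := by
    intro Y hY
    let E : (Fin m → ℤ) × (ℤ × (Fin m → ℤ) × ℤ) → ℕ := fun y => Nat.log 2 y.2.2.2.toNat
    have hE : ∀ y ∈ Y, (2 : ℝ) ^ E y ≤ y.2.2.2 ∧ (y.2.2.2 : ℝ) < 2 * 2 ^ E y := by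
      intro y hy
      have h1 := (hY y hy).2.1
      have h2 : (y.2.2.2.toNat : ℤ) = y.2.2.2 := Int.toNat_of_nonneg h1.le
      have h3 : (y.2.2.2.toNat : ℝ) = y.2.2.2 := by exact_mod_cast h2
      have h4 : y.2.2.2.toNat ≠ 0 := by omega
      rw [← h3]
      constructor
      · exact_mod_cast Nat.pow_log_le_self 2 h4
      · have := Nat.lt_pow_succ_log_self (b := 2) (by norm_num) y.2.2.2.toNat
        rw [pow_succ'] at this
        exact_mod_cast this
    have hEn : ∀ y ∈ Y, E y + 2 * s < n := by
      intro y hy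
      have h1 := (hE y hy).1.trans (hY y hy).2.2.1
      rw [le_div_iff₀ (by positivity)] at h1
      have h2 : (2 : ℝ) ^ (E y + 2 * s + 1) ≤ 2 ^ n := by
        calc (2 : ℝ) ^ (E y + 2 * s + 1) = 2 ^ E y * (2 * R ^ 2) := by rw [hR]; ring
          _ ≤ _ := h1
      exact (pow_le_pow_iff_right₀ (by norm_num : (1 : ℝ) < 2)).mp h2
    have hmaps : ∀ y ∈ Y, E y ∈ Finset.range (n - 2 * s) := by
      intro y hy
      have := hEn y hy
      rw [Finset.mem_range]; omega
    have hfib : ∀ i ∈ Finset.range (n - 2 * s), ((Y.filter fun y => E y = i).card : ℝ) ≤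
        C1 * A * (B / R ^ 2) ^ m * (1 / √2) ^ (n - 2 * s - i) := by
      intro i hi
      rw [Finset.mem_range] at hi
      have hBe : B = R ^ 2 * 2 ^ i * 2 ^ (n - 2 * s - i) := by
        rw [hB, hR, ← pow_mul, ← pow_add, ← pow_add]; congr 1; omega
      have hΛ : B / (R ^ 2 * 2 ^ i) = 2 ^ (n - 2 * s - i) := by
        rw [hBe]; field_simp
      have h2s : 2 * s < n := by omega
      have hρ2 : ρ ≤ 1 := by
        rw [hρ, div_le_one (by positivity)]
        have h1 : R ≤ B := pow_le_pow_right₀ (by norm_num) (by omega)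
        have h2 : B ≤ L * B := le_mul_of_one_le_left hB0.le hL
        linarith
      have := hlev f fs G Gs hf R B (2 ^ i) (A * (2 ^ i) ^ m) (by linarith) hLs
        (one_le_pow₀ (by norm_num)) ?_ (hrec i (by omega)) z (Y.filter fun y => E y = i) ?_
      · refine this.trans_eq ?_
        rw [hΛ]
        have h3 : √((2 : ℝ) ^ (n - 2 * s - i)) = √2 ^ (n - 2 * s - i) := by
          rw [← Real.sqrt_sq (by positivity : 0 ≤ √2 ^ (n - 2 * s - i)), ← pow_mul, mul_comm _ 2,
            pow_mul, Real.sq_sqrt (by norm_num)]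
        have h4 : B / R ^ 2 = 2 ^ i * 2 ^ (n - 2 * s - i) := by
          rw [hBe]; field_simp
        rw [h3, h4, mul_pow, one_div, inv_pow]
        field_simp
      · have : (1 : ℝ) ≤ 2 ^ (n - 2 * s - i) := one_le_pow₀ (by norm_num)
        rw [hBe]
        exact le_mul_of_one_le_right (by positivity) this
      · intro y hy
        obtain ⟨hyY, rfl⟩ := Finset.mem_filter.mp hy
        refine ⟨(hY y hyY).1, hE y hyY, fun i => ?_⟩
        have := hXz y.1 (hY y hyY).2.2.2 i
        linarith
    have hq : 1 / √2 ≤ 4 / 5 := by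
      rw [div_le_iff₀ (by positivity)]
      have : 5 / 4 ≤ √2 := Real.le_sqrt_of_sq_le (by norm_num)
      linarith
    calc (Y.card : ℝ) = ∑ i ∈ Finset.range (n - 2 * s), ((Y.filter fun y => E y = i).card : ℝ) := by
          exact_mod_cast Finset.card_eq_sum_card_fiberwise hmaps
      _ ≤ _ := Finset.sum_le_sum hfib
      _ = C1 * A * (B / R ^ 2) ^ m * ∑ i ∈ Finset.range (n - 2 * s), (1 / √2) ^ (n - 2 * s - i) := by
          rw [Finset.mul_sum]
      _ ≤ C1 * A * (B / R ^ 2) ^ m * 4 := by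
          gcongr
          exact sum_geometric_reflect_le (by positivity) hq _
      _ = _ := by ring
  let e : (Σ _ : Fin m → ℤ, ℤ × (Fin m → ℤ) × ℤ) → (Fin m → ℤ) × (ℤ × (Fin m → ℤ) × ℤ) :=
    fun p => (p.1, p.2)
  have he : Function.Injective e := by
    rintro ⟨a, b⟩ ⟨a', b'⟩ h
    simp only [e, Prod.mk.injEq] at h
    obtain ⟨rfl, rfl⟩ := h
    rfl
  set Y := (X.sigma H).image e with hY
  have hYc : (Y.card : ℝ) = ∑ k ∈ X, ((H k).card : ℝ) := by
    rw [hY, Finset.card_image_of_injective _ he, Finset.card_sigma]; push_cast; rfl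
  have hYm : ∀ y ∈ Y, y.1 ∈ X ∧ y.2 ∈ H y.1 := by
    intro y hy
    obtain ⟨p, hp, rfl⟩ := Finset.mem_image.mp hy
    exact Finset.mem_sigma.mp hp
  have hY0 : ((Y.filter fun y => y.2.2.2 = 0).card : ℝ) ≤ X.card := by
    have hzero : ∀ y ∈ Y.filter (fun y => y.2.2.2 = 0), y.2 = 0 := by
      intro y hy
      obtain ⟨h1, h2⟩ := Finset.mem_filter.mp hy
      obtain ⟨⟨h3, h4⟩, -⟩ := hH1 y.1 y.2 (hYm y h1).2
      have small : ∀ (a : ℤ) (D : ℝ), 1 ≤ D → |(a : ℝ)| ≤ 1 / (2 * D) → a = 0 := by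
        intro a D hD h
        have : |(a : ℝ)| < 1 := by
          refine h.trans_lt ?_
          rw [div_lt_one (by positivity)]; linarith
        exact Int.abs_lt_one_iff.mp (by exact_mod_cast this)
      have h5 : y.2.2.1 = 0 := by
        funext i
        have := h4 i
        rw [h2] at this
        exact small _ R (by linarith) (by simpa using this)
      have h6 : y.2.1 = 0 := by
        rw [h2, h5] at h3
        exact small _ B hB1 (by simpa using h3)
      exact Prod.ext h6 (Prod.ext h5 h2)
    have : (Y.filter fun y => y.2.2.2 = 0).card ≤ X.card := by
      refine Finset.card_le_card_of_injOn Prod.fst ?_ ?_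
      · intro y hy
        exact (hYm y (Finset.mem_filter.mp hy).1).1
      · intro y hy y' hy' h
        exact Prod.ext h ((hzero y hy).trans (hzero y' hy').symm)
    exact_mod_cast this
  have hYp := hpos (Y.filter fun y => 0 < y.2.2.2) (by
    intro y hy
    obtain ⟨h1, h2⟩ := Finset.mem_filter.mp hy
    obtain ⟨h3, h4⟩ := hH1 y.1 y.2 (hYm y h1).2
    exact ⟨h3, h2, (le_abs_self _).trans h4, (hYm y h1).1⟩)
  have hYn : ((Y.filter fun y => y.2.2.2 < 0).card : ℝ) ≤ 4 * C1 * A * (B / R ^ 2) ^ m := by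
    let ν : (Fin m → ℤ) × (ℤ × (Fin m → ℤ) × ℤ) → (Fin m → ℤ) × (ℤ × (Fin m → ℤ) × ℤ) :=
      fun y => (y.1, -y.2)
    have hν : Function.Injective ν := by
      intro y y' h
      simp only [ν, Prod.mk.injEq, neg_inj] at h
      exact Prod.ext h.1 h.2
    rw [← Finset.card_image_of_injective _ hν]
    refine hpos _ fun y hy => ?_
    obtain ⟨y', hy', rfl⟩ := Finset.mem_image.mp hy
    obtain ⟨h1, h2⟩ := Finset.mem_filter.mp hy'
    obtain ⟨h3, h4⟩ := hH1 y'.1 y'.2 (hYm y' h1).2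
    refine ⟨h3.neg, ?_, ?_, (hYm y' h1).1⟩
    · simpa [ν] using h2
    · refine le_trans ?_ h4
      simpa [ν] using neg_le_abs (y'.2.2.2 : ℝ)
  have hsplit : (Y.card : ℝ) ≤ (Y.filter fun y => y.2.2.2 = 0).card +
      (Y.filter fun y => 0 < y.2.2.2).card + (Y.filter fun y => y.2.2.2 < 0).card := by
    have : Y ⊆ (Y.filter fun y => y.2.2.2 = 0) ∪ (Y.filter fun y => 0 < y.2.2.2) ∪
        (Y.filter fun y => y.2.2.2 < 0) := by
      intro y hy
      simp only [Finset.mem_union, Finset.mem_filter]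
      rcases lt_trichotomy y.2.2.2 0 with h | h | h <;> simp [hy, h]
    have h1 := Finset.card_le_card this
    have h2 := h1.trans ((Finset.card_union_le _ _).trans
      (Nat.add_le_add_right (Finset.card_union_le _ _) _))
    exact_mod_cast h2
  have hYtot : (Y.card : ℝ) ≤ (6 * L) ^ m * B ^ m + 8 * C1 * A * (B / R ^ 2) ^ m := by
    linarith
  calc (T.card : ℝ) = ∑ k ∈ X, ((T.filter fun p => F p = k).card : ℝ) := by
        exact_mod_cast Finset.card_eq_sum_card_image F T
    _ ≤ ∑ k ∈ X, C0 * R ^ (m + 2) * (H k).card := Finset.sum_le_sum fun k _ => hH2 k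
    _ = C0 * R ^ (m + 2) * Y.card := by rw [hYc, Finset.mul_sum]
    _ ≤ C0 * R ^ (m + 2) * ((6 * L) ^ m * B ^ m + 8 * C1 * A * (B / R ^ 2) ^ m) := by gcongr
    _ = (C0 * (6 * L) ^ m * R ^ (m + 2) + 8 * C0 * C1 * (R ^ 2 / R ^ m) * A) * B ^ m := by
        have h1 : (R ^ 2) ^ m = R ^ m * R ^ m := by rw [← pow_mul, mul_comm, pow_mul, sq]
        rw [div_pow, h1, pow_add]
        field_simp
    _ ≤ _ := by
        have : 0 ≤ C0 * (6 * L) ^ m := by positivity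
        have : 0 ≤ 8 * C0 * C1 := by positivity
        gcongr <;> linarith

/-- The growth factor, on top of `B ^ m`, in the bound for the number of triples of height `B`. -/
noncomputable def growth (m : ℕ) (c t : ℝ) : ℝ := if m = 2 then Real.exp (c * √t) else 1

lemma exists_scale {L C : ℝ} : ∃ s : ℕ, 1 ≤ s ∧ L ^ 3 ≤ ((2 : ℝ) ^ s) ^ 2 ∧ C ≤ 2 ^ s := by
  obtain ⟨s, hs⟩ := pow_unbounded_of_one_lt (max (L ^ 3) (max C 1)) (by norm_num : (1 : ℝ) < 2)
  have h1 : L ^ 3 ≤ 2 ^ s := (le_max_left _ _).trans hs.le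
  have h2 : C ≤ 2 ^ s := ((le_max_left _ _).trans (le_max_right _ _)).trans hs.le
  have h3 : (1 : ℝ) < 2 ^ s := ((le_max_right _ _).trans (le_max_right _ _)).trans_lt hs
  refine ⟨s, ?_, ?_, h2⟩
  · by_contra! h
    simp [Nat.lt_one_iff.mp h] at h3
  · nlinarith

lemma card_near_le (m : ℕ) (hm : 2 ≤ m) {L c : ℝ} (hL : 1 ≤ L) (hc : 0 < c) :
    ∃ K > (0 : ℝ), ∃ c' > (0 : ℝ), ∀ (f fs : (Fin m → ℝ) → ℝ) (G Gs : (Fin m → ℝ) → (Fin m → ℝ)),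
      DualPair L c f fs G Gs → ∀ (n : ℕ) (z : Fin m → ℝ) (T : Finset (ℤ × (Fin m → ℤ) × ℤ)),
        (∀ p ∈ T, Near f (2 ^ n) z p) → (T.card : ℝ) ≤ K * growth m c' n * (2 ^ n) ^ m := by
  obtain ⟨C, hC, hrec⟩ := card_near_le_of_dual m hL hc
  have hC0 : 0 < C := by linarith
  rcases hm.eq_or_lt with rfl | hm3
  · obtain ⟨s0, hs0, hLs0, -⟩ := exists_scale (L := L) (C := 1)
    have hlog : 0 < Real.log (32 * C) := Real.log_pos (by linarith)
    refine ⟨C * 16 ^ s0, by positivity, Real.log (32 * C), hlog, ?_⟩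
    have main : ∀ s : ℕ, s0 ≤ s → ∀ n : ℕ, ∀ (f fs : (Fin 2 → ℝ) → ℝ)
        (G Gs : (Fin 2 → ℝ) → (Fin 2 → ℝ)), DualPair L c f fs G Gs →
        ∀ (z : Fin 2 → ℝ) (T : Finset (ℤ × (Fin 2 → ℤ) × ℤ)),
        (∀ p ∈ T, Near f (2 ^ n) z p) →
          (T.card : ℝ) ≤ (C * (2 ^ s) ^ 4 * (2 * C) ^ (n / (2 * s))) * (2 ^ n) ^ 2 := by
      intro s hs n
      have hLs : L ^ 3 ≤ ((2 : ℝ) ^ s) ^ 2 := by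
        refine hLs0.trans ?_
        gcongr
        norm_num
      induction n using Nat.strong_induction_on with
      | _ n ih =>
        intro f fs G Gs hf z T hT
        rcases lt_or_ge n (2 * s) with hn | hn
        · have := hrec f fs G Gs hf s n (hs0.trans hs) hLs 0 le_rfl
            (fun i hi => by omega) z T hT
          rw [Nat.div_eq_of_lt hn]
          simpa using this
        · set k := (n - 2 * s) / (2 * s)
          have hk : n / (2 * s) = k + 1 := by
            rw [Nat.div_eq_sub_div (by omega) hn]
          have := hrec f fs G Gs hf s n (hs0.trans hs) hLs (C * (2 ^ s) ^ 4 * (2 * C) ^ k)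
            (by positivity) ?_ z T hT
          · refine this.trans ?_
            rw [hk]
            have h1 : (1 : ℝ) ≤ (2 * C) ^ k := one_le_pow₀ (by linarith)
            have h2 : ((2 : ℝ) ^ s) ^ 2 / (2 ^ s) ^ 2 = 1 := div_self (by positivity)
            rw [h2]
            gcongr
            set D := C * ((2 : ℝ) ^ s) ^ 4
            have hD : 0 < D := by positivity
            have h3 : 1 ≤ C * (2 * C) ^ k := one_le_mul_of_one_le_of_one_le hC h1
            calc D + C * 1 * (D * (2 * C) ^ k) = D * (1 + C * (2 * C) ^ k) := by ring
              _ ≤ D * (C * (2 * C) ^ k + C * (2 * C) ^ k) := by gcongr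
              _ = _ := by ring
          · intro i hi z T hT
            refine (ih i (by omega) fs f Gs G ⟨hf.2, hf.1⟩ z T hT).trans ?_
            gcongr
            · linarith
            · exact Nat.div_le_div_right (by omega)
    intro f fs G Gs hf n z T hT
    refine (main (s0 + Nat.sqrt n) (by omega) n f fs G Gs hf z T hT).trans
      (mul_le_mul_of_nonneg_right ?_ (by positivity))
    have h1 : n / (2 * (s0 + Nat.sqrt n)) ≤ Nat.sqrt n := by
      apply Nat.div_le_of_le_mul
      have := Nat.sqrt_lt'.mp (Nat.lt_succ_self (Nat.sqrt n))
      nlinarith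
    have h2 : (Nat.sqrt n : ℝ) ≤ √n := Real.nat_sqrt_le_real_sqrt
    have h3 : ((2 : ℝ) ^ (s0 + Nat.sqrt n)) ^ 4 = 16 ^ s0 * 16 ^ Nat.sqrt n := by
      rw [← pow_mul, mul_comm, pow_mul, pow_add]; norm_num
    calc C * (2 ^ (s0 + Nat.sqrt n)) ^ 4 * (2 * C) ^ (n / (2 * (s0 + Nat.sqrt n)))
        ≤ C * (2 ^ (s0 + Nat.sqrt n)) ^ 4 * (2 * C) ^ Nat.sqrt n := by
          gcongr
          linarith
      _ = C * 16 ^ s0 * (32 * C) ^ Nat.sqrt n := by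
          rw [h3, show 32 * C = 16 * (2 * C) by ring, mul_pow 16 (2 * C)]; ring
      _ = C * 16 ^ s0 * Real.exp (Real.log (32 * C) * Nat.sqrt n) := by
          rw [mul_comm (Real.log _), Real.exp_nat_mul, Real.exp_log (by positivity)]
      _ ≤ C * 16 ^ s0 * growth 2 (Real.log (32 * C)) n := by
          rw [growth, if_pos rfl]
          gcongr
  · obtain ⟨s, hs, hLs, hCs⟩ := exists_scale (L := L) (C := 2 * C)
    set R : ℝ := 2 ^ s with hR
    have hR0 : 0 < R := by positivity
    have hR1 : 1 ≤ R := one_le_pow₀ (by norm_num)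
    refine ⟨2 * C * R ^ (m + 2), by positivity, 1, one_pos, ?_⟩
    have hhalf : C * (R ^ 2 / R ^ m) ≤ 1 / 2 := by
      have h1 : R ^ 3 ≤ R ^ m := pow_le_pow_right₀ hR1 hm3
      calc C * (R ^ 2 / R ^ m) ≤ C * (R ^ 2 / R ^ 3) := by gcongr
        _ = C / R := by field_simp
        _ ≤ 1 / 2 := by rw [div_le_div_iff₀ hR0 (by norm_num)]; linarith
    have main : ∀ n : ℕ, ∀ (f fs : (Fin m → ℝ) → ℝ)
        (G Gs : (Fin m → ℝ) → (Fin m → ℝ)), DualPair L c f fs G Gs →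
        ∀ (z : Fin m → ℝ) (T : Finset (ℤ × (Fin m → ℤ) × ℤ)),
        (∀ p ∈ T, Near f (2 ^ n) z p) → (T.card : ℝ) ≤ 2 * C * R ^ (m + 2) * (2 ^ n) ^ m := by
      intro n
      induction n using Nat.strong_induction_on with
      | _ n ih =>
        intro f fs G Gs hf z T hT
        refine (hrec f fs G Gs hf s n hs hLs (2 * C * R ^ (m + 2)) (by positivity)
          (fun i hi => ih i (by omega) fs f Gs G ⟨hf.2, hf.1⟩) z T hT).trans ?_
        gcongr
        calc C * R ^ (m + 2) + C * (R ^ 2 / R ^ m) * (2 * C * R ^ (m + 2))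
            ≤ C * R ^ (m + 2) + 1 / 2 * (2 * C * R ^ (m + 2)) := by gcongr
          _ = _ := by ring
    intro f fs G Gs hf n z T hT
    rw [growth, if_neg (by omega), mul_one]
    exact main n f fs G Gs hf z T hT

/-- The triple `(q, a, b)` has `1 ≤ q ≤ B` and gives a rational point `(a / q, b / q)` on the
graph of `f` over the unit ball around `z`. -/
def OnGraph {m : ℕ} (f : (Fin m → ℝ) → ℝ) (B : ℝ) (z : Fin m → ℝ) (p : ℤ × (Fin m → ℤ) × ℤ) :
    Prop :=
  (1 ≤ p.1 ∧ (p.1 : ℝ) ≤ B) ∧ (∀ i, |(p.2.1 i : ℝ) / p.1 - z i| ≤ 1) ∧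
    (p.2.2 : ℝ) = p.1 * f (fun i => p.2.1 i / p.1)

lemma card_onGraph_le (m : ℕ) (hm : 2 ≤ m) {L c : ℝ} (hL : 1 ≤ L) (hc : 0 < c) :
    ∃ K > (0 : ℝ), ∃ c' > (0 : ℝ), ∀ (f fs : (Fin m → ℝ) → ℝ) (G Gs : (Fin m → ℝ) → (Fin m → ℝ)),
      DualPair L c f fs G Gs → ∀ (B : ℝ) (z : Fin m → ℝ) (T : Finset (ℤ × (Fin m → ℤ) × ℤ)),
        1 ≤ B → (∀ p ∈ T, OnGraph f B z p) →
          (T.card : ℝ) ≤ K * growth m c' (Real.log B) * B ^ m := by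
  classical
  obtain ⟨K, hK, c', hc', h⟩ := card_near_le m hm hL hc
  refine ⟨2 * K, by positivity, c' / √(Real.log 2), by positivity, ?_⟩
  intro f fs G Gs hf B z T hB hT
  set N := Nat.log 2 ⌊B⌋₊ with hN
  have hfl : ⌊B⌋₊ ≠ 0 := (Nat.floor_pos.mpr hB).ne'
  have hNB : (2 : ℝ) ^ N ≤ B := by
    have h1 : (2 : ℕ) ^ N ≤ ⌊B⌋₊ := Nat.pow_log_le_self 2 hfl
    calc (2 : ℝ) ^ N = ((2 ^ N : ℕ) : ℝ) := by push_cast; rfl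
      _ ≤ ⌊B⌋₊ := by exact_mod_cast h1
      _ ≤ B := Nat.floor_le (by linarith)
  let E : ℤ × (Fin m → ℤ) × ℤ → ℕ := fun p => Nat.log 2 p.1.toNat
  have hE : ∀ p ∈ T, E p ≤ N ∧ (2 : ℝ) ^ E p ≤ p.1 ∧ (p.1 : ℝ) < 2 * 2 ^ E p := by
    intro p hp
    obtain ⟨⟨h1, h1'⟩, -⟩ := hT p hp
    have h2 : (p.1.toNat : ℤ) = p.1 := Int.toNat_of_nonneg (by omega)
    have h3 : (p.1.toNat : ℝ) = p.1 := by exact_mod_cast h2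
    have h4 : p.1.toNat ≠ 0 := by omega
    refine ⟨Nat.log_mono_right (Nat.le_floor (by rw [h3]; exact h1')), ?_⟩
    rw [← h3]
    constructor
    · exact_mod_cast Nat.pow_log_le_self 2 h4
    · have := Nat.lt_pow_succ_log_self (b := 2) (by norm_num) p.1.toNat
      rw [pow_succ'] at this
      exact_mod_cast this
  have hmaps : ∀ p ∈ T, E p ∈ Finset.range (N + 1) := fun p hp =>
    Finset.mem_range.mpr (Nat.lt_succ_of_le (hE p hp).1)
  have hgrow : ∀ i ≤ N, growth m c' i ≤ growth m (c' / √(Real.log 2)) (Real.log B) := by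
    intro i hi
    unfold growth
    split_ifs
    · have h1 : (i : ℝ) ≤ Real.log B / Real.log 2 := by
        rw [le_div_iff₀ (Real.log_pos (by norm_num)), ← Real.log_pow]
        refine Real.log_le_log (by positivity) (le_trans ?_ hNB)
        exact pow_le_pow_right₀ (by norm_num) hi
      have h2 : √(i : ℝ) ≤ √(Real.log B) / √(Real.log 2) := by
        rw [← Real.sqrt_div (Real.log_nonneg hB)]
        exact Real.sqrt_le_sqrt h1
      refine Real.exp_le_exp.mpr ?_
      calc c' * √(i : ℝ) ≤ c' * (√(Real.log B) / √(Real.log 2)) := by gcongr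
        _ = _ := by ring
    · exact le_rfl
  set W := growth m (c' / √(Real.log 2)) (Real.log B)
  have hW : 0 ≤ W := by
    simp only [W, growth]
    split_ifs <;> positivity
  have hfib : ∀ i ∈ Finset.range (N + 1), ((T.filter fun p => E p = i).card : ℝ) ≤
      K * W * ((2 : ℝ) ^ m) ^ i := by
    intro i hi
    have := h f fs G Gs hf i z (T.filter fun p => E p = i) ?_
    · refine this.trans ?_
      rw [← pow_mul, mul_comm i m, pow_mul]
      gcongr
      exact hgrow i (Nat.lt_succ_iff.mp (Finset.mem_range.mp hi))
    · intro p hp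
      obtain ⟨hpT, rfl⟩ := Finset.mem_filter.mp hp
      obtain ⟨-, h2, h3⟩ := hT p hpT
      refine ⟨(hE p hpT).2, h2, ?_⟩
      rw [h3, sub_self, abs_zero]
      positivity
  have hgeo : ∑ i ∈ Finset.range (N + 1), ((2 : ℝ) ^ m) ^ i ≤ 2 * ((2 : ℝ) ^ m) ^ N := by
    have h2 : (2 : ℝ) ≤ 2 ^ m := by
      calc (2 : ℝ) = 2 ^ 1 := by norm_num
        _ ≤ _ := pow_le_pow_right₀ (by norm_num) (by omega)
    generalize (2 : ℝ) ^ m = x at h2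
    clear_value N
    clear hNB hE hmaps hfib hgrow hN
    induction N with
    | zero => simp
    | succ N ih =>
      rw [Finset.sum_range_succ]
      have : (0 : ℝ) < x ^ N := by positivity
      have h3 : x ^ (N + 1) = x ^ N * x := pow_succ _ _
      nlinarith
  calc (T.card : ℝ) = ∑ i ∈ Finset.range (N + 1), ((T.filter fun p => E p = i).card : ℝ) := by
        exact_mod_cast Finset.card_eq_sum_card_fiberwise hmaps
    _ ≤ ∑ i ∈ Finset.range (N + 1), K * W * ((2 : ℝ) ^ m) ^ i := Finset.sum_le_sum hfib
    _ = K * W * ∑ i ∈ Finset.range (N + 1), ((2 : ℝ) ^ m) ^ i := by rw [Finset.mul_sum]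
    _ ≤ K * W * (2 * ((2 : ℝ) ^ m) ^ N) := by gcongr
    _ = 2 * K * W * (2 ^ N) ^ m := by rw [← pow_mul, ← pow_mul, mul_comm m N]; ring
    _ ≤ _ := by gcongr

/-- Three rational points in increasing order on a strictly convex curve, all of whose coordinates
`(q, a, b)` are divisible by `g`, are spread out. -/
lemma spread_of_three {f G : ℝ → ℝ} {L : ℝ} (hL : 1 ≤ L)
    (htaylor : ∀ x x', |f x' - f x - G x * (x' - x)| ≤ L * |x' - x| ^ 2)
    (hconv : ∀ x s t, 0 < s → 0 < t → t * f (x - s) + s * f (x + t) - (s + t) * f x ≠ 0)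
    {B : ℝ} {g : ℤ} {q a b : Fin 3 → ℤ} (hq : ∀ i, 1 ≤ q i ∧ (q i : ℝ) ≤ B)
    (hb : ∀ i, (b i : ℝ) = q i * f (a i / q i)) (hdvd : ∀ i, g ∣ q i ∧ g ∣ a i ∧ g ∣ b i)
    (h01 : (a 0 : ℝ) / q 0 < a 1 / q 1) (h12 : (a 1 : ℝ) / q 1 < a 2 / q 2) :
    g / (L * B) ≤ (a 2 : ℝ) / q 2 - a 0 / q 0 := by
  set x0 := (a 0 : ℝ) / q 0 with hx0
  set x := (a 1 : ℝ) / q 1 with hx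
  set x2 := (a 2 : ℝ) / q 2 with hx2
  have hq0 : ∀ i, 0 < (q i : ℝ) := fun i => by exact_mod_cast (hq i).1
  have hB : 0 < B := (hq0 0).trans_le (hq 0).2
  set s := x - x0 with hs
  set t := x2 - x with ht
  have hs0 : 0 < s := by linarith
  have ht0 : 0 < t := by linarith
  have e0 : x - s = x0 := by rw [hs]; ring
  have e2 : x + t = x2 := by rw [ht]; ring
  set Δ := t * f x0 + s * f x2 - (s + t) * f x with hΔ
  have hΔ0 : Δ ≠ 0 := by
    have := hconv x s t hs0 ht0
    rwa [e0, e2] at this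
  set d : ℤ := (q 0 * (a 1 * b 2 - a 2 * b 1) - a 0 * (q 1 * b 2 - q 2 * b 1)
    + b 0 * (q 1 * a 2 - q 2 * a 1)) with hd
  have hdΔ : (d : ℝ) = q 0 * q 1 * q 2 * Δ := by
    have ha0 : (a 0 : ℝ) = q 0 * x0 := by rw [hx0]; have := (hq0 0).ne'; field_simp
    have ha1 : (a 1 : ℝ) = q 1 * x := by rw [hx]; have := (hq0 1).ne'; field_simp
    have ha2 : (a 2 : ℝ) = q 2 * x2 := by rw [hx2]; have := (hq0 2).ne'; field_simp
    rw [hd]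
    push_cast
    rw [hb 0, hb 1, hb 2, ← hx0, ← hx, ← hx2, ha0, ha1, ha2, hΔ, hs, ht]
    ring
  have hg3 : g ^ 3 ∣ d := by
    obtain ⟨⟨q0, hq0⟩, ⟨a0, ha0⟩, ⟨b0, hb0⟩⟩ := hdvd 0
    obtain ⟨⟨q1, hq1⟩, ⟨a1, ha1⟩, ⟨b1, hb1⟩⟩ := hdvd 1
    obtain ⟨⟨q2, hq2⟩, ⟨a2, ha2⟩, ⟨b2, hb2⟩⟩ := hdvd 2
    refine ⟨q0 * (a1 * b2 - a2 * b1) - a0 * (q1 * b2 - q2 * b1) + b0 * (q1 * a2 - q2 * a1), ?_⟩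
    rw [hd, hq0, ha0, hb0, hq1, ha1, hb1, hq2, ha2, hb2]
    ring
  have hQ : 0 < (q 0 : ℝ) * q 1 * q 2 := mul_pos (mul_pos (hq0 0) (hq0 1)) (hq0 2)
  have hd0 : d ≠ 0 := by
    intro h
    rw [h] at hdΔ
    exact mul_ne_zero hQ.ne' hΔ0 (by exact_mod_cast hdΔ.symm)
  have hgd : (g : ℝ) ^ 3 ≤ |(d : ℝ)| := by
    have := Int.le_of_dvd (abs_pos.mpr hd0) ((dvd_abs _ _).mpr hg3)
    exact_mod_cast this
  have hΔle : |Δ| ≤ L * (s + t) ^ 3 := by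
    have t0 := htaylor x x0
    have t2 := htaylor x x2
    have h1 : |x0 - x| = s := by rw [abs_sub_comm, abs_of_pos hs0]
    have h2 : |x2 - x| = t := abs_of_pos ht0
    rw [h1] at t0
    rw [h2] at t2
    have e : Δ = t * (f x0 - f x - G x * (x0 - x)) + s * (f x2 - f x - G x * (x2 - x)) := by
      rw [hΔ, hs, ht]; ring
    rw [e]
    calc _ ≤ _ := abs_add_le _ _
      _ ≤ t * (L * s ^ 2) + s * (L * t ^ 2) := by
          rw [abs_mul, abs_mul, abs_of_pos hs0, abs_of_pos ht0]; gcongr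
      _ ≤ _ := by
          have : 0 ≤ L * (s ^ 3 + t ^ 3 + 2 * (s * t * (s + t))) := by positivity
          nlinarith
  have hfin : (g : ℝ) ^ 3 ≤ (L * B * (s + t)) ^ 3 := by
    calc (g : ℝ) ^ 3 ≤ |(d : ℝ)| := hgd
      _ = q 0 * q 1 * q 2 * |Δ| := by rw [hdΔ, abs_mul, abs_of_pos hQ]
      _ ≤ B * B * B * (L * (s + t) ^ 3) := by
          gcongr
          · exact (hq0 2).le
          · exact (hq0 1).le
          · exact (hq 0).2
          · exact (hq 1).2
          · exact (hq 2).2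
      _ = 1 * 1 * L * (B * (s + t)) ^ 3 := by ring
      _ ≤ L * L * L * (B * (s + t)) ^ 3 := by gcongr
      _ = _ := by ring
  have := le_of_pow_le_pow_left₀ (by norm_num) (by positivity) hfin
  rw [div_le_iff₀ (by positivity)]
  calc (g : ℝ) ≤ _ := this
    _ = (x2 - x0) * (L * B) := by rw [hs, ht]; ring

lemma card_onGraph_le_of_one {L c : ℝ} (hL : 1 ≤ L) (hc : 0 < c)
    {f fs : (Fin 1 → ℝ) → ℝ} {G Gs : (Fin 1 → ℝ) → (Fin 1 → ℝ)}
    (hf : HalfPair L c f fs G Gs) {B : ℝ} (hB : 1 ≤ B) (z : Fin 1 → ℝ)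
    (T : Finset (ℤ × (Fin 1 → ℤ) × ℤ)) (hT : ∀ p ∈ T, OnGraph f B z p) :
    (T.card : ℝ) ≤ 6 * L * B * (1 + Real.log B) := by
  classical
  let φ : ℝ → ℝ := fun x => f fun _ => x
  let γ : ℝ → ℝ := fun x => G (fun _ => x) 0
  have htaylor : ∀ x x', |φ x' - φ x - γ x * (x' - x)| ≤ L * |x' - x| ^ 2 := by
    intro x x'
    have := hf.taylor (fun _ => x) (fun _ => x')
    have e : ‖(fun _ : Fin 1 => x') - fun _ => x‖ = |x' - x| := by
      rw [← Real.norm_eq_abs]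
      exact pi_norm_const (ι := Fin 1) (x' - x)
    rw [e] at this
    simpa [φ, γ] using this
  have hconv : ∀ x s t, 0 < s → 0 < t → t * φ (x - s) + s * φ (x + t) - (s + t) * φ x ≠ 0 := by
    obtain ⟨σ, e, -, -, hconv⟩ := hf.conv
    have he0 : e 0 ≠ 0 := by
      intro h
      have h1 := hconv 0 1
      have h2 : (fun i => (0 : Fin 1 → ℝ) i + 1 * (e i : ℝ)) = 0 := by
        funext i
        simp [Subsingleton.elim i 0, h]
      rw [h2] at h1
      simp [h] at h1
      linarith
    have hgen : ∀ (x u : ℝ), c * (u / e 0) ^ 2 ≤ σ * (φ (x + u) - φ x - u * γ x) := by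
      intro x u
      have := hconv (fun _ => x) (u / e 0)
      have he0' : (e 0 : ℝ) ≠ 0 := by exact_mod_cast he0
      have h1 : (fun i : Fin 1 => x + u / e 0 * (e i : ℝ)) = fun _ => x + u := by
        funext i
        rw [Subsingleton.elim i 0, div_mul_cancel₀ _ he0']
      rw [h1, Fin.sum_univ_one] at this
      refine this.trans_eq ?_
      simp only [φ, γ]
      field_simp
    intro x s t hs ht h
    have h1 := hgen x (-s)
    have h2 := hgen x t
    rw [← sub_eq_add_neg] at h1
    have he0' : (e 0 : ℝ) ≠ 0 := by exact_mod_cast he0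
    have p1 : 0 < c * (-s / e 0) ^ 2 := by
      have : -s / (e 0 : ℝ) ≠ 0 := div_ne_zero (neg_ne_zero.mpr hs.ne') he0'
      positivity
    have p2 : 0 < c * (t / e 0) ^ 2 := by positivity
    have p3 := mul_pos ht (p1.trans_le h1)
    have p4 := mul_pos hs (p2.trans_le h2)
    have : t * (σ * (φ (x - s) - φ x - -s * γ x)) + s * (σ * (φ (x + t) - φ x - t * γ x)) =
        σ * (t * φ (x - s) + s * φ (x + t) - (s + t) * φ x) := by ring
    rw [h, mul_zero] at this
    linarith
  let g : ℤ × (Fin 1 → ℤ) × ℤ → ℕ := fun p => Int.gcd p.1 (Int.gcd (p.2.1 0) p.2.2)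
  let v : ℤ × (Fin 1 → ℤ) × ℤ → ℝ := fun p => p.2.1 0 / p.1
  have hfv : ∀ p ∈ T, (p.2.2 : ℝ) = p.1 * φ (v p) := by
    intro p hp
    rw [(hT p hp).2.2]
    congr 2
    funext i
    rw [Subsingleton.elim i 0]
  have hgdvd : ∀ p, (g p : ℤ) ∣ p.1 ∧ (g p : ℤ) ∣ p.2.1 0 ∧ (g p : ℤ) ∣ p.2.2 := fun p =>
    ⟨Int.gcd_dvd_left _ _, (Int.gcd_dvd_right _ _).trans (Int.gcd_dvd_left _ _),
      (Int.gcd_dvd_right _ _).trans (Int.gcd_dvd_right _ _)⟩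
  have hmaps : ∀ p ∈ T, g p ∈ Finset.Icc 1 ⌊B⌋₊ := by
    intro p hp
    obtain ⟨⟨h1, h1'⟩, -⟩ := hT p hp
    have h2 : 0 < g p := Int.gcd_pos_of_ne_zero_left _ (by omega)
    have h3 := Int.le_of_dvd (by omega) (hgdvd p).1
    refine Finset.mem_Icc.mpr ⟨h2, Nat.le_floor ?_⟩
    have : ((g p : ℤ) : ℝ) ≤ p.1 := by exact_mod_cast h3
    exact le_trans (by exact_mod_cast this) h1'
  have hinj : ∀ k, Set.InjOn v ((T.filter fun p => g p = k : Finset _) :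
      Set (ℤ × (Fin 1 → ℤ) × ℤ)) := by
    intro k p hp p' hp' hv
    obtain ⟨hpT, hpk⟩ := Finset.mem_filter.mp (Finset.mem_coe.mp hp)
    obtain ⟨hpT', hpk'⟩ := Finset.mem_filter.mp (Finset.mem_coe.mp hp')
    have h1 := (hT p hpT).1.1
    have h1' := (hT p' hpT').1.1
    have q0 : (0 : ℝ) < p.1 := by exact_mod_cast h1
    have q0' : (0 : ℝ) < p'.1 := by exact_mod_cast h1'
    have ha : p'.1 * p.2.1 0 = p.1 * p'.2.1 0 := by
      have : (p.2.1 0 : ℝ) / p.1 = p'.2.1 0 / p'.1 := hv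
      rw [div_eq_div_iff q0.ne' q0'.ne'] at this
      have h2 : (p'.1 : ℝ) * p.2.1 0 = p.1 * p'.2.1 0 := by linarith
      exact_mod_cast h2
    have hb : p'.1 * p.2.2 = p.1 * p'.2.2 := by
      have : (p'.1 : ℝ) * p.2.2 = p.1 * p'.2.2 := by
        rw [hfv p hpT, hfv p' hpT', hv]; ring
      exact_mod_cast this
    have hgg : p'.1.natAbs * g p = p.1.natAbs * g p' := by
      simp only [g]
      rw [← Int.gcd_mul_left, ← Int.gcd_mul_left, mul_comm p'.1 p.1]
      congr 1
      have e1 : p'.1 * ((Int.gcd (p.2.1 0) p.2.2 : ℕ) : ℤ) =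
          Int.gcd (p'.1 * p.2.1 0) (p'.1 * p.2.2) := by
        rw [Int.gcd_mul_left]; push_cast; rw [abs_of_pos (by omega)]
      have e2 : p.1 * ((Int.gcd (p'.2.1 0) p'.2.2 : ℕ) : ℤ) =
          Int.gcd (p.1 * p'.2.1 0) (p.1 * p'.2.2) := by
        rw [Int.gcd_mul_left]; push_cast; rw [abs_of_pos (by omega)]
      rw [e1, e2, ha, hb]
    have hk0 : 0 < k := by
      rw [← hpk]
      exact (Finset.mem_Icc.mp (hmaps p hpT)).1
    rw [hpk, hpk'] at hgg
    have hqq : p.1 = p'.1 := by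
      have := Nat.eq_of_mul_eq_mul_right hk0 hgg
      omega
    refine Prod.ext hqq (Prod.ext (funext fun i => ?_) ?_)
    · rw [Subsingleton.elim i 0]
      rw [hqq] at ha
      exact mul_left_cancel₀ (by omega) ha
    · rw [hqq] at hb
      exact mul_left_cancel₀ (by omega) hb
  have hfib : ∀ k ∈ Finset.Icc 1 ⌊B⌋₊, ((T.filter fun p => g p = k).card : ℝ) ≤
      6 * L * B * (k : ℝ)⁻¹ := by
    intro k hk
    obtain ⟨hk1, hkB⟩ := Finset.mem_Icc.mp hk
    have hk0 : (0 : ℝ) < k := by exact_mod_cast hk1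
    have hkB' : (k : ℝ) ≤ B := (Nat.le_floor_iff (by linarith)).mp hkB
    set S := (T.filter fun p => g p = k).image v with hS
    have hSc : (T.filter fun p => g p = k).card = S.card := by
      rw [hS, Finset.card_image_of_injOn (hinj k)]
    set w := L * B / k with hw
    have hw1 : 1 ≤ w := by
      rw [hw, le_div_iff₀ hk0]
      nlinarith
    let E : ℝ → ℤ := fun x => ⌊(x - (z 0 - 1)) * w⌋
    have h2 : ∀ i ∈ S.image E, (S.filter fun x => E x = i).card ≤ 2 := by
      intro i _
      by_contra! hcon
      obtain ⟨x0, h0, x1, h1, x2, h2, h01, h12⟩ := exists_lt_lt_of_two_lt_card hcon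
      obtain ⟨h0, e0⟩ := Finset.mem_filter.mp h0
      obtain ⟨h1, e1⟩ := Finset.mem_filter.mp h1
      obtain ⟨h2, e2⟩ := Finset.mem_filter.mp h2
      obtain ⟨p0, hp0, rfl⟩ := Finset.mem_image.mp h0
      obtain ⟨p1, hp1, rfl⟩ := Finset.mem_image.mp h1
      obtain ⟨p2, hp2, rfl⟩ := Finset.mem_image.mp h2
      obtain ⟨hp0, g0⟩ := Finset.mem_filter.mp hp0
      obtain ⟨hp1, g1⟩ := Finset.mem_filter.mp hp1
      obtain ⟨hp2, g2⟩ := Finset.mem_filter.mp hp2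
      have key := spread_of_three (f := φ) (G := γ) hL htaylor hconv (B := B) (g := k)
        (q := ![p0.1, p1.1, p2.1]) (a := ![p0.2.1 0, p1.2.1 0, p2.2.1 0])
        (b := ![p0.2.2, p1.2.2, p2.2.2])
        (by
          intro i
          fin_cases i
          exacts [(hT p0 hp0).1, (hT p1 hp1).1, (hT p2 hp2).1])
        (by
          intro i
          fin_cases i
          exacts [hfv p0 hp0, hfv p1 hp1, hfv p2 hp2])
        (by
          intro i
          fin_cases i
          exacts [g0 ▸ hgdvd p0, g1 ▸ hgdvd p1, g2 ▸ hgdvd p2]) h01 h12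
      have key' : (k : ℝ) / (L * B) ≤ v p2 - v p0 := by
        rw [Int.cast_natCast] at key
        exact key
      have f2 := Int.lt_floor_add_one ((v p2 - (z 0 - 1)) * w)
      have f0 := Int.floor_le ((v p0 - (z 0 - 1)) * w)
      have : E (v p2) = E (v p0) := e2.trans e0.symm
      simp only [E] at this
      rw [this] at f2
      have h3 : (k : ℝ) / (L * B) * w = 1 := by rw [hw]; field_simp
      have h4 : (k : ℝ) / (L * B) * w ≤ (v p2 - v p0) * w := by gcongr
      nlinarith
    have hle := Finset.card_le_mul_card_image (f := E) S 2 h2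
    have himg : ((S.image E).card : ℝ) ≤ 2 * w + 1 := by
      have hsub : S.image E ⊆ Finset.Icc 0 ⌊2 * w⌋ := by
        intro i hi
        obtain ⟨x, hx, rfl⟩ := Finset.mem_image.mp hi
        obtain ⟨p, hp, rfl⟩ := Finset.mem_image.mp hx
        have hv := abs_le.mp ((hT p (Finset.mem_filter.mp hp).1).2.1 0)
        have hv' : v p = p.2.1 0 / p.1 := rfl
        rw [← hv'] at hv
        refine Finset.mem_Icc.mpr ⟨Int.floor_nonneg.mpr ?_, Int.floor_le_floor ?_⟩
        · apply mul_nonneg <;> linarith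
        · gcongr; linarith
      have h5 := Finset.card_le_card hsub
      rw [Int.card_Icc] at h5
      have h6 : (0 : ℤ) ≤ ⌊2 * w⌋ := Int.floor_nonneg.mpr (by positivity)
      have h7 : ((S.image E).card : ℤ) ≤ ⌊2 * w⌋ + 1 := by omega
      have h8 : ((S.image E).card : ℝ) ≤ ⌊2 * w⌋ + 1 := by exact_mod_cast h7
      linarith [Int.floor_le (2 * w)]
    have hle' : (S.card : ℝ) ≤ 2 * (S.image E).card := by exact_mod_cast hle
    rw [hSc]
    calc (S.card : ℝ) ≤ 6 * w := by linarith
      _ = _ := by rw [hw]; field_simp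
  calc (T.card : ℝ) = ∑ k ∈ Finset.Icc 1 ⌊B⌋₊, ((T.filter fun p => g p = k).card : ℝ) := by
        exact_mod_cast Finset.card_eq_sum_card_fiberwise hmaps
    _ ≤ _ := Finset.sum_le_sum hfib
    _ = 6 * L * B * (harmonic ⌊B⌋₊ : ℝ) := by
        rw [← Finset.mul_sum, harmonic_eq_sum_Icc]; push_cast; rfl
    _ ≤ _ := by
        gcongr
        exact harmonic_floor_le_one_add_log B hB

/-- The shape of the bound for the number of rational points of height at most `B`. -/
noncomputable def countBound (m : ℕ) (c B : ℝ) : ℝ :=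
  if m = 1 then B * Real.log B
  else if m = 2 then B ^ 2 * Real.exp (c * √(Real.log B))
  else B ^ m * Real.log B ^ (1 : ℝ)

lemma countBound_mono {m : ℕ} {c c' B : ℝ} (h : c ≤ c') : countBound m c B ≤ countBound m c' B := by
  unfold countBound
  split_ifs
  · exact le_rfl
  · gcongr
  · exact le_rfl

lemma countBound_nonneg {m : ℕ} {c B : ℝ} (hB : 1 ≤ B) : 0 ≤ countBound m c B := by
  have := Real.log_nonneg hB
  unfold countBound
  split_ifs <;> positivity

theorem card_onGraph_le_countBound (m : ℕ) (hm : 1 ≤ m) {L c : ℝ} (hL : 1 ≤ L) (hc : 0 < c) :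
    ∃ C > (0 : ℝ), ∃ c' > (0 : ℝ), ∀ (f fs : (Fin m → ℝ) → ℝ) (G Gs : (Fin m → ℝ) → (Fin m → ℝ)),
      DualPair L c f fs G Gs → ∀ (B : ℝ) (z : Fin m → ℝ) (T : Finset (ℤ × (Fin m → ℤ) × ℤ)),
        2 ≤ B → (∀ p ∈ T, OnGraph f B z p) → (T.card : ℝ) ≤ C * countBound m c' B := by
  have hlog : ∀ B : ℝ, 2 ≤ B → 1 ≤ 2 * Real.log B := by
    intro B hB
    have h1 := Real.log_le_log (by norm_num) hB
    linarith [Real.log_two_gt_d9]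
  rcases hm.eq_or_lt with rfl | hm2
  · refine ⟨18 * L, by positivity, 1, one_pos, ?_⟩
    intro f fs G Gs hf B z T hB hT
    refine (card_onGraph_le_of_one hL hc hf.1 (by linarith) z T hT).trans ?_
    rw [countBound, if_pos rfl]
    have := hlog B hB
    calc 6 * L * B * (1 + Real.log B) ≤ 6 * L * B * (2 * Real.log B + Real.log B) := by gcongr
      _ = _ := by ring
  · obtain ⟨K, hK, c', hc', h⟩ := card_onGraph_le m hm2 hL hc
    refine ⟨2 * K, by positivity, c', hc', ?_⟩
    intro f fs G Gs hf B z T hB hT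
    refine (h f fs G Gs hf B z T (by linarith) hT).trans ?_
    have := hlog B hB
    rw [countBound, if_neg (by omega), growth, Real.rpow_one]
    split_ifs with h2
    · subst h2
      have : 0 ≤ K * Real.exp (c' * √(Real.log B)) * B ^ 2 := by positivity
      linarith
    · calc K * 1 * B ^ m ≤ K * (2 * Real.log B) * B ^ m := by gcongr
        _ = _ := by ring

section Extension
variable {E : Type*} [NormedAddCommGroup E] [NormedSpace ℝ E]

/-- A smooth retraction-like map: the identity near the origin, with bounded image. -/
lemma exists_smooth_truncation [FiniteDimensional ℝ E] :
    ∃ (ψ : E → E) (M M' : ℝ), 0 ≤ M ∧ 0 ≤ M' ∧ Differentiable ℝ ψ ∧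
    (∀ x ∈ Metric.ball (0 : E) 1, ψ x = x) ∧ (∀ x, ‖ψ x‖ ≤ 2) ∧
    (∀ x x', ‖ψ x - ψ x'‖ ≤ M * ‖x - x'‖) ∧ (∀ x, ‖fderiv ℝ ψ x‖ ≤ M) ∧
    (∀ x x', ‖fderiv ℝ ψ x - fderiv ℝ ψ x'‖ ≤ M' * ‖x - x'‖) := by
  let χ : ContDiffBump (0 : E) := ⟨1, 2, one_pos, one_lt_two⟩
  let ψ : E → E := fun x => χ x • x
  have hs : ContDiff ℝ (2 : ℕ) ψ := (χ.contDiff).smul contDiff_id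
  have hc : HasCompactSupport ψ := χ.hasCompactSupport.smul_right
  obtain ⟨M, hM⟩ := ContDiff.lipschitzWith_of_hasCompactSupport hc hs (by simp)
  obtain ⟨M', hM'⟩ := ContDiff.lipschitzWith_of_hasCompactSupport (hc.fderiv (𝕜 := ℝ))
    (hs.fderiv_right (m := (1 : ℕ)) (by norm_num)) (by simp)
  refine ⟨ψ, M, M', M.2, M'.2, hs.differentiable (by simp), fun x hx => ?_, fun x => ?_,
    fun x x' => ?_, fun x => norm_fderiv_le_of_lipschitz ℝ hM, fun x x' => ?_⟩
  · simp only [ψ]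
    rw [χ.one_of_mem_closedBall (Metric.ball_subset_closedBall hx), one_smul]
  · simp only [ψ]
    by_cases hx : x ∈ Metric.ball (0 : E) 2
    · rw [norm_smul, Real.norm_eq_abs, abs_of_nonneg χ.nonneg]
      have := mem_ball_zero_iff.mp hx
      calc χ x * ‖x‖ ≤ 1 * 2 := by
            exact mul_le_mul χ.le_one this.le (norm_nonneg _) zero_le_one
        _ = 2 := one_mul _
    · rw [χ.zero_of_le_dist (by simpa using hx)]; simp
  · simpa [dist_eq_norm] using hM.dist_le_mul x x'
  · simpa [dist_eq_norm] using hM'.dist_le_mul x x'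

lemma exists_extension_small [FiniteDimensional ℝ E] {g₀ : E → ℝ} {z₀ : E}
    (hg : ContDiffAt ℝ 2 g₀ z₀)
    (h1 : fderiv ℝ g₀ z₀ = 0) (h2 : fderiv ℝ (fderiv ℝ g₀) z₀ = 0) {ε : ℝ} (hε : 0 < ε) :
    ∃ r > 0, ∃ (g : E → ℝ) (Dg : E → E →L[ℝ] ℝ), (∀ x, HasFDerivAt g (Dg x) x) ∧
      (∀ x x', ‖Dg x - Dg x'‖ ≤ ε * ‖x - x'‖) ∧ ∀ x ∈ Metric.ball z₀ r, g x = g₀ x := by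
  obtain ⟨ψ, M, M', hM0, hM0', hd, hid, hb, hlip, hdb, hdlip⟩ := exists_smooth_truncation (E := E)
  set ε₀ := ε / (M ^ 2 + 2 * M' + 1) with hε₀
  have hε₀' : 0 < ε₀ := by positivity
  have hs : HasStrictFDerivAt (fderiv ℝ g₀) (0 : E →L[ℝ] E →L[ℝ] ℝ) z₀ := by
    rw [← h2]
    exact (hg.fderiv_right (m := 1) (by norm_num)).hasStrictFDerivAt (by simp)
  have hL : ∀ᶠ p : E × E in nhds (z₀, z₀), ‖fderiv ℝ g₀ p.1 - fderiv ℝ g₀ p.2‖ ≤ ε₀ * ‖p.1 - p.2‖ := by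
    have := hs.isLittleO.def hε₀'
    simpa using this
  have hdiff : ∀ᶠ x in nhds z₀, DifferentiableAt ℝ g₀ x :=
    (hg.eventually (by simp)).mono fun x hx => hx.differentiableAt (by simp)
  obtain ⟨δ₁, hδ₁, H1⟩ := Metric.eventually_nhds_iff.mp hL
  obtain ⟨δ₂, hδ₂, H2⟩ := Metric.eventually_nhds_iff.mp hdiff
  set r := min δ₁ δ₂ / 3 with hr
  have hr0 : 0 < r := by positivity
  have hr1 : 2 * r < δ₁ := by have := min_le_left δ₁ δ₂; linarith
  have hr2 : 2 * r < δ₂ := by have := min_le_right δ₁ δ₂; linarith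
  let P : E → E := fun x => z₀ + r • ψ (r⁻¹ • (x - z₀))
  let DP : E → E →L[ℝ] E := fun x => fderiv ℝ ψ (r⁻¹ • (x - z₀))
  have hP : ∀ x, ‖P x - z₀‖ ≤ 2 * r := by
    intro x
    simp only [P, add_sub_cancel_left, norm_smul, Real.norm_eq_abs, abs_of_pos hr0]
    nlinarith [hb (r⁻¹ • (x - z₀))]
  have hsc : ∀ x x' : E, ‖r⁻¹ • (x - z₀) - r⁻¹ • (x' - z₀)‖ = r⁻¹ * ‖x - x'‖ := by
    intro x x'
    rw [← smul_sub, norm_smul, Real.norm_eq_abs, abs_of_pos (by positivity)]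
    congr 2; abel
  have hPl : ∀ x x', ‖P x - P x'‖ ≤ M * ‖x - x'‖ := by
    intro x x'
    simp only [P, add_sub_add_left_eq_sub, ← smul_sub, norm_smul, Real.norm_eq_abs, abs_of_pos hr0]
    calc _ ≤ r * (M * (r⁻¹ * ‖x - x'‖)) := by
          rw [← hsc]; exact mul_le_mul_of_nonneg_left (hlip _ _) hr0.le
      _ = _ := by field_simp
  have hPd : ∀ x, HasFDerivAt P (DP x) x := by
    intro x
    have e1 : HasFDerivAt (fun x : E => r⁻¹ • (x - z₀)) (r⁻¹ • ContinuousLinearMap.id ℝ E) x :=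
      ((hasFDerivAt_id x).sub_const z₀).const_smul r⁻¹
    have e2 := (((hd (r⁻¹ • (x - z₀))).hasFDerivAt.comp x e1).const_smul r).const_add z₀
    have e3 : DP x = r • (fderiv ℝ ψ (r⁻¹ • (x - z₀))).comp (r⁻¹ • ContinuousLinearMap.id ℝ E) := by
      ext v
      simp [DP, smul_smul, hr0.ne']
    rw [e3]
    exact e2
  refine ⟨r, hr0, g₀ ∘ P, fun x => (fderiv ℝ g₀ (P x)).comp (DP x), fun x => ?_, fun x x' => ?_,
    fun x hx => ?_⟩
  · refine HasFDerivAt.comp x (H2 ?_).hasFDerivAt (hPd x)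
    rw [dist_eq_norm]; exact (hP x).trans_lt hr2
  · have hmem : ∀ x, dist (P x) z₀ < δ₁ := fun x => by
      rw [dist_eq_norm]; exact (hP x).trans_lt hr1
    have k1 : ‖fderiv ℝ g₀ (P x) - fderiv ℝ g₀ (P x')‖ ≤ ε₀ * (M * ‖x - x'‖) := by
      have := @H1 (P x, P x') (by rw [Prod.dist_eq]; exact max_lt (hmem x) (hmem x'))
      exact this.trans (mul_le_mul_of_nonneg_left (hPl x x') hε₀'.le)
    have k2 : ‖fderiv ℝ g₀ (P x')‖ ≤ ε₀ * (2 * r) := by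
      have := @H1 (P x', z₀) (by rw [Prod.dist_eq]; exact max_lt (hmem x') (by simpa using hδ₁))
      simp only [h1, sub_zero] at this
      exact this.trans (mul_le_mul_of_nonneg_left (hP x') hε₀'.le)
    have k3 : ‖DP x - DP x'‖ ≤ M' * (r⁻¹ * ‖x - x'‖) := by
      rw [← hsc]; exact hdlip _ _
    have k4 : ‖DP x‖ ≤ M := hdb _
    have e : (fderiv ℝ g₀ (P x)).comp (DP x) - (fderiv ℝ g₀ (P x')).comp (DP x') =
        (fderiv ℝ g₀ (P x) - fderiv ℝ g₀ (P x')).comp (DP x) +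
        (fderiv ℝ g₀ (P x')).comp (DP x - DP x') := by
      ext v; simp
    rw [e]
    calc _ ≤ ‖fderiv ℝ g₀ (P x) - fderiv ℝ g₀ (P x')‖ * ‖DP x‖ +
          ‖fderiv ℝ g₀ (P x')‖ * ‖DP x - DP x'‖ :=
        (norm_add_le _ _).trans (add_le_add (ContinuousLinearMap.opNorm_comp_le _ _)
          (ContinuousLinearMap.opNorm_comp_le _ _))
      _ ≤ ε₀ * (M * ‖x - x'‖) * M + ε₀ * (2 * r) * (M' * (r⁻¹ * ‖x - x'‖)) := by
        gcongr
      _ = ε₀ * (M ^ 2 + 2 * M') * ‖x - x'‖ := by field_simp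
      _ ≤ ε₀ * (M ^ 2 + 2 * M' + 1) * ‖x - x'‖ := by
        apply mul_le_mul_of_nonneg_right _ (norm_nonneg _)
        nlinarith
      _ = ε * ‖x - x'‖ := by rw [hε₀]; field_simp
  · have : ψ (r⁻¹ • (x - z₀)) = r⁻¹ • (x - z₀) := by
      apply hid
      rw [mem_ball_zero_iff, norm_smul, Real.norm_eq_abs, abs_of_pos (by positivity),
        ← div_eq_inv_mul, div_lt_one hr0, ← dist_eq_norm]
      exact hx
    simp only [Function.comp, P, this, smul_smul, mul_inv_cancel₀ hr0.ne', one_smul]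
    simp

lemma hasFDerivAt_half_quadratic {Q : E →L[ℝ] E →L[ℝ] ℝ} (hQ : ∀ v w, Q v w = Q w v) (z x : E) :
    HasFDerivAt (fun y => 1 / 2 * Q (y - z) (y - z)) (Q (x - z)) x := by
  have e1 : HasFDerivAt (fun y : E => y - z) (ContinuousLinearMap.id ℝ E) x :=
    (hasFDerivAt_id x).sub_const z
  have e2 := ((Q.hasFDerivAt.comp x e1).clm_apply e1).const_mul (1 / 2 : ℝ)
  have e3 : Q (x - z) = (1 / 2 : ℝ) • (((Q ∘ fun y => y - z) x).comp (ContinuousLinearMap.id ℝ E) +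
      (Q.comp (ContinuousLinearMap.id ℝ E)).flip (x - z)) := by
    ext v
    simp [hQ v x, hQ v z]
    ring
  rw [e3]
  exact e2

/-- A `C²` function agrees near a point with a globally defined function that is a small
perturbation of a quadratic form. -/
lemma exists_extension [FiniteDimensional ℝ E] {F : E → ℝ} {z₀ : E}
    (hF : ContDiffAt ℝ 2 F z₀) {ε : ℝ} (hε : 0 < ε) :
    ∃ r > 0, ∃ (f : E → ℝ) (Df : E → E →L[ℝ] ℝ), (∀ x, HasFDerivAt f (Df x) x) ∧
      (∀ x x', ‖Df x - Df x' - fderiv ℝ (fderiv ℝ F) z₀ (x - x')‖ ≤ ε * ‖x - x'‖) ∧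
      ∀ x ∈ Metric.ball z₀ r, f x = F x := by
  set Q := fderiv ℝ (fderiv ℝ F) z₀ with hQ
  have hsymm : ∀ v w, Q v w = Q w v := hF.isSymmSndFDerivAt (by simp)
  let q : E → ℝ := fun x => fderiv ℝ F z₀ x + 1 / 2 * Q (x - z₀) (x - z₀)
  have hq : ∀ x, HasFDerivAt q (fderiv ℝ F z₀ + Q (x - z₀)) x := fun x =>
    (fderiv ℝ F z₀).hasFDerivAt.add (hasFDerivAt_half_quadratic hsymm z₀ x)
  have hqs : ContDiff ℝ 2 q := by
    have : ContDiff ℝ 2 fun x : E => x - z₀ := contDiff_id.sub contDiff_const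
    exact (fderiv ℝ F z₀).contDiff.add
      (contDiff_const.mul ((Q.contDiff.comp this).clm_apply this))
  have hfd : fderiv ℝ (fun x => F x - q x) =ᶠ[nhds z₀]
      fun x => fderiv ℝ F x - (fderiv ℝ F z₀ + Q (x - z₀)) := by
    filter_upwards [hF.eventually (by simp)] with x hx
    exact ((hx.differentiableAt (by simp)).hasFDerivAt.sub (hq x)).fderiv
  have hd2 : HasFDerivAt (fun x => fderiv ℝ F x - (fderiv ℝ F z₀ + Q (x - z₀)))
      (Q - Q.comp (ContinuousLinearMap.id ℝ E)) z₀ :=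
    ((hF.fderiv_right (m := 1) (by norm_num)).differentiableAt (by simp)).hasFDerivAt.sub
      ((Q.hasFDerivAt.comp z₀ ((hasFDerivAt_id z₀).sub_const z₀)).const_add _)
  obtain ⟨r, hr, g, Dg, hg, hgl, hge⟩ := exists_extension_small (g₀ := fun x => F x - q x)
    (hF.sub hqs.contDiffAt) (by rw [hfd.self_of_nhds]; simp)
    (by rw [hfd.fderiv_eq, hd2.fderiv]; ext; simp) hε
  refine ⟨r, hr, fun x => g x + q x, fun x => Dg x + (fderiv ℝ F z₀ + Q (x - z₀)),
    fun x => (hg x).add (hq x), fun x x' => ?_, fun x hx => by simp only [hge x hx]; ring⟩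
  have : Dg x + (fderiv ℝ F z₀ + Q (x - z₀)) - (Dg x' + (fderiv ℝ F z₀ + Q (x' - z₀))) -
      Q (x - x') = Dg x - Dg x' := by
    simp only [map_sub]; abel
  rw [this]
  exact hgl x x'

lemma abs_sub_quadratic_le {f : E → ℝ} {Df : E → E →L[ℝ] ℝ} {Q : E →L[ℝ] E →L[ℝ] ℝ} {ε : ℝ}
    (hQ : ∀ v w, Q v w = Q w v) (hε : 0 ≤ ε) (hf : ∀ x, HasFDerivAt f (Df x) x)
    (hl : ∀ x x', ‖Df x - Df x' - Q (x - x')‖ ≤ ε * ‖x - x'‖) (x x' : E) :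
    |f x' - f x - Df x (x' - x) - 1 / 2 * Q (x' - x) (x' - x)| ≤ ε * ‖x' - x‖ ^ 2 := by
  have hd : ∀ y, HasFDerivAt (fun y => f y - Df x (y - x) - 1 / 2 * Q (y - x) (y - x))
      (Df y - Df x - Q (y - x)) y := by
    intro y
    have e1 : HasFDerivAt (fun y => Df x (y - x)) (Df x) y := by
      exact (Df x).hasFDerivAt.comp y ((hasFDerivAt_id y).sub_const x)
    exact ((hf y).sub e1).sub (hasFDerivAt_half_quadratic hQ x y)
  have := (convex_closedBall x ‖x' - x‖).norm_image_sub_le_of_norm_hasFDerivWithin_le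
    (C := ε * ‖x' - x‖) (fun y _ => (hd y).hasFDerivWithinAt) (fun y hy => ?_)
    (Metric.mem_closedBall_self (norm_nonneg _)) (by simp [dist_eq_norm] : x' ∈ _)
  · rw [Real.norm_eq_abs] at this
    simp only [sub_self, map_zero, mul_zero, sub_zero] at this
    calc _ = |f x' - Df x (x' - x) - 1 / 2 * Q (x' - x) (x' - x) - f x| := by congr 1; ring
      _ ≤ _ := this
      _ = _ := by ring
  · refine (hl y x).trans (mul_le_mul_of_nonneg_left ?_ hε)
    simpa [dist_eq_norm] using hy

end Extension

section QuadraticPair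
variable {m : ℕ}

lemma clm_apply_eq_sum (φ : (Fin m → ℝ) →L[ℝ] ℝ) (v : Fin m → ℝ) :
    φ v = ∑ i, φ (Pi.single i 1) * v i := by
  conv_lhs => rw [pi_eq_sum_univ' v]
  simp [mul_comm]

/-- A nonzero symmetric bilinear form takes a nonzero value at a small integer vector. -/
lemma exists_int_quadratic_ne_zero {Q : (Fin m → ℝ) →L[ℝ] (Fin m → ℝ) →L[ℝ] ℝ}
    (hQ : ∀ v w, Q v w = Q w v) (h0 : Q ≠ 0) :
    ∃ e : Fin m → ℤ, (∀ i, |(e i : ℝ)| ≤ 1) ∧ Q (fun i => e i) (fun i => e i) ≠ 0 := by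
  by_contra! hcon
  have hb : ∀ i, Q (Pi.single i 1) (Pi.single i 1) = 0 := by
    intro i
    have hs : (fun k => ((Pi.single i 1 : Fin m → ℤ) k : ℝ)) = Pi.single i 1 := by
      ext k
      by_cases h : k = i
      · subst h; simp
      · simp [h]
    rw [← hs]
    refine hcon _ fun k => ?_
    by_cases h : k = i
    · subst h; simp
    · simp [h]
  have hb2 : ∀ i k, Q (Pi.single i 1) (Pi.single k 1) = 0 := by
    intro i k
    by_cases hik : i = k
    · rw [hik]; exact hb k
    have hs : (fun l => ((Pi.single i 1 + Pi.single k 1 : Fin m → ℤ) l : ℝ)) =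
        Pi.single i 1 + Pi.single k 1 := by
      ext l
      by_cases h : l = i
      · subst h; simp [hik]
      · by_cases h' : l = k
        · subst h'; simp [h]
        · simp [h, h']
    have := hcon (Pi.single i 1 + Pi.single k 1) fun l => by
      by_cases h : l = i
      · subst h; simp [hik]
      · by_cases h' : l = k
        · subst h'; simp [h]
        · simp [h, h']
    rw [hs] at this
    simp only [map_add, add_apply, hb, hQ (Pi.single k 1) (Pi.single i 1)]
      at this
    linarith
  apply h0
  ext v w
  rw [clm_apply_eq_sum (Q v) w]
  refine Finset.sum_eq_zero fun i _ => ?_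
  rw [hQ, clm_apply_eq_sum (Q _) v]
  simp [hb2]

lemma taylor_of_quadratic {f : (Fin m → ℝ) → ℝ} {G : (Fin m → ℝ) → (Fin m → ℝ)}
    {Q : (Fin m → ℝ) →L[ℝ] (Fin m → ℝ) →L[ℝ] ℝ} {ε : ℝ}
    (h : ∀ x x', |f x' - f x - ∑ i, G x i * (x' i - x i) - 1 / 2 * Q (x' - x) (x' - x)| ≤
      ε * ‖x' - x‖ ^ 2) (x x' : Fin m → ℝ) :
    |f x' - f x - ∑ i, G x i * (x' i - x i)| ≤ (‖Q‖ + ε) * ‖x' - x‖ ^ 2 := by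
  have h1 := h x x'
  have h2 := Q.le_opNorm₂ (x' - x) (x' - x)
  rw [Real.norm_eq_abs] at h2
  have h3 : 0 ≤ ‖Q‖ * ‖x' - x‖ * ‖x' - x‖ := by positivity
  rw [abs_le] at *
  constructor <;> nlinarith

lemma conv_of_quadratic {f : (Fin m → ℝ) → ℝ} {G : (Fin m → ℝ) → (Fin m → ℝ)}
    {Q : (Fin m → ℝ) →L[ℝ] (Fin m → ℝ) →L[ℝ] ℝ} {ε c : ℝ} (hε : 0 ≤ ε)
    (h : ∀ x x', |f x' - f x - ∑ i, G x i * (x' i - x i) - 1 / 2 * Q (x' - x) (x' - x)| ≤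
      ε * ‖x' - x‖ ^ 2) {e : Fin m → ℤ} (he : ∀ i, |(e i : ℝ)| ≤ 1)
    (hc : c + ε ≤ |Q (fun i => e i) (fun i => e i)| / 2) :
    ∃ (σ : ℝ) (e : Fin m → ℤ), |σ| ≤ 1 ∧ (∀ i, |(e i : ℝ)| ≤ 1) ∧ ∀ (x : Fin m → ℝ) (t : ℝ),
      c * t ^ 2 ≤ σ * (f (fun i => x i + t * e i) - f x - t * ∑ i, G x i * e i) := by
  have key : ∀ (x : Fin m → ℝ) (t : ℝ), |f (fun i => x i + t * e i) - f x -
      t * ∑ i, G x i * e i - t ^ 2 * (Q (fun i => e i) (fun i => e i) / 2)| ≤ ε * t ^ 2 := by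
    intro x t
    have h1 := h x (fun i => x i + t * e i)
    have h2 : (fun i => x i + t * (e i : ℝ)) - x = t • fun i => (e i : ℝ) := by
      ext i; simp
    have h3 : ‖t • fun i => (e i : ℝ)‖ ^ 2 ≤ t ^ 2 := by
      rw [← sq_abs t, norm_smul, Real.norm_eq_abs]
      have : ‖fun i => (e i : ℝ)‖ ≤ 1 := (pi_norm_le_iff_of_nonneg zero_le_one).mpr he
      exact pow_le_pow_left₀ (by positivity) (mul_le_of_le_one_right (abs_nonneg _) this) 2
    rw [h2] at h1
    calc _ = _ := ?_
      _ ≤ _ := h1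
      _ ≤ _ := mul_le_mul_of_nonneg_left h3 hε
    congr 1
    have h4 : ∑ i, G x i * (x i + t * e i - x i) = t * ∑ i, G x i * e i := by
      rw [Finset.mul_sum]; exact Finset.sum_congr rfl fun i _ => by ring
    rw [h4]
    simp only [map_smul, smul_apply, smul_eq_mul]
    ring
  rcases le_or_gt 0 (Q (fun i => e i) (fun i => e i)) with hq | hq
  · refine ⟨1, e, by simp, he, fun x t => ?_⟩
    rw [abs_of_nonneg hq] at hc
    have := (abs_le.mp (key x t)).1
    nlinarith [sq_nonneg t]
  · refine ⟨-1, e, by simp, he, fun x t => ?_⟩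
    rw [abs_of_neg hq] at hc
    have := (abs_le.mp (key x t)).2
    nlinarith [sq_nonneg t]

section Dual
variable {f : (Fin m → ℝ) → ℝ} {G Gs : (Fin m → ℝ) → (Fin m → ℝ)}
  {Q : (Fin m → ℝ) →L[ℝ] (Fin m → ℝ) →L[ℝ] ℝ} {H : (Fin m → ℝ) ≃L[ℝ] (Fin m → ℝ)} {ε : ℝ}

/-- The quadratic form dual to `Q`. -/
noncomputable def dualForm (Q : (Fin m → ℝ) →L[ℝ] (Fin m → ℝ) →L[ℝ] ℝ)
    (H : (Fin m → ℝ) ≃L[ℝ] (Fin m → ℝ)) : (Fin m → ℝ) →L[ℝ] (Fin m → ℝ) →L[ℝ] ℝ :=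
  Q.bilinearComp (H.symm : (Fin m → ℝ) →L[ℝ] (Fin m → ℝ)) (H.symm : (Fin m → ℝ) →L[ℝ] (Fin m → ℝ))

lemma dualForm_apply (v w : Fin m → ℝ) : dualForm Q H v w = Q (H.symm v) (H.symm w) := rfl

lemma lipschitz_of_near_linear (hG : ∀ x x', ‖G x - G x' - H (x - x')‖ ≤ ε * ‖x - x'‖)
    (x x' : Fin m → ℝ) :
    ‖G x - G x'‖ ≤ (‖(H : (Fin m → ℝ) →L[ℝ] (Fin m → ℝ))‖ + ε) * ‖x - x'‖ := by
  have h1 := (H : (Fin m → ℝ) →L[ℝ] (Fin m → ℝ)).le_opNorm (x - x')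
  calc ‖G x - G x'‖ = ‖(G x - G x' - H (x - x')) + H (x - x')‖ := by congr 1; abel
    _ ≤ _ := norm_add_le _ _
    _ ≤ ε * ‖x - x'‖ + _ := add_le_add (hG x x') h1
    _ = _ := by ring

lemma inverse_near_linear {N : ℝ}
    (hN : ‖(H.symm : (Fin m → ℝ) →L[ℝ] (Fin m → ℝ))‖ ≤ N)
    (hG : ∀ x x', ‖G x - G x' - H (x - x')‖ ≤ ε * ‖x - x'‖) (x x' : Fin m → ℝ) :
    ‖(x - x') - H.symm (G x - G x')‖ ≤ N * ε * ‖x - x'‖ := by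
  have e : (x - x') - H.symm (G x - G x') = -(H.symm (G x - G x' - H (x - x'))) := by
    rw [map_sub H.symm (G x - G x'), H.symm_apply_apply]; abel
  rw [e, norm_neg]
  calc _ ≤ N * ‖G x - G x' - H (x - x')‖ :=
        (H.symm : (Fin m → ℝ) →L[ℝ] (Fin m → ℝ)).le_of_opNorm_le hN _
    _ ≤ N * (ε * ‖x - x'‖) := mul_le_mul_of_nonneg_left (hG x x') ((norm_nonneg _).trans hN)
    _ = _ := by ring

lemma inverse_lipschitz {N : ℝ}
    (hN : ‖(H.symm : (Fin m → ℝ) →L[ℝ] (Fin m → ℝ))‖ ≤ N) (hNε : N * ε ≤ 1 / 2)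
    (hG : ∀ x x', ‖G x - G x' - H (x - x')‖ ≤ ε * ‖x - x'‖) (x x' : Fin m → ℝ) :
    ‖x - x'‖ ≤ 2 * N * ‖G x - G x'‖ := by
  have h1 := inverse_near_linear hN hG x x'
  have h2 : ‖H.symm (G x - G x')‖ ≤ N * ‖G x - G x'‖ :=
    (H.symm : (Fin m → ℝ) →L[ℝ] (Fin m → ℝ)).le_of_opNorm_le hN _
  have h3 := norm_le_norm_add_norm_sub (H.symm (G x - G x')) (x - x')
  rw [norm_sub_rev (H.symm _)] at h3
  nlinarith [norm_nonneg (x - x'), mul_le_mul_of_nonneg_right hNε (norm_nonneg (x - x'))]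

lemma dual_quadratic {N : ℝ} (hε : 0 ≤ ε)
    (hN : ‖(H.symm : (Fin m → ℝ) →L[ℝ] (Fin m → ℝ))‖ ≤ N) (hNε : N * ε ≤ 1 / 2)
    (hG : ∀ x x', ‖G x - G x' - H (x - x')‖ ≤ ε * ‖x - x'‖) (hGs : ∀ y, G (Gs y) = y)
    (h : ∀ x x', |f x' - f x - ∑ i, G x i * (x' i - x i) - 1 / 2 * Q (x' - x) (x' - x)| ≤
      ε * ‖x' - x‖ ^ 2) {fs : (Fin m → ℝ) → ℝ} (hfs : ∀ y, fs y = ∑ i, Gs y i * y i - f (Gs y))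
    (y y' : Fin m → ℝ) :
    |fs y' - fs y - ∑ i, Gs y i * (y' i - y i) - 1 / 2 * dualForm Q H (y' - y) (y' - y)| ≤
      (4 * N ^ 2 + 3 * ‖Q‖ * N ^ 3) * ε * ‖y' - y‖ ^ 2 := by
  have hN0 : 0 ≤ N := (norm_nonneg _).trans hN
  set d := Gs y' - Gs y with hd
  set s := H.symm (y' - y) with hs
  have e1 : fs y' - fs y - ∑ i, Gs y i * (y' i - y i) =
      f (Gs y) - f (Gs y') - ∑ i, G (Gs y') i * (Gs y i - Gs y' i) := by
    rw [hfs, hfs, hGs]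
    have : ∑ i, Gs y' i * y' i - ∑ i, Gs y i * y i - ∑ i, Gs y i * (y' i - y i) =
        - ∑ i, y' i * (Gs y i - Gs y' i) := by
      rw [← Finset.sum_sub_distrib, ← Finset.sum_sub_distrib, ← Finset.sum_neg_distrib]
      exact Finset.sum_congr rfl fun i _ => by ring
    linarith
  have h1 := h (Gs y') (Gs y)
  rw [← e1] at h1
  have e2 : Gs y - Gs y' = -d := by rw [hd]; abel
  rw [e2] at h1
  simp only [map_neg, neg_apply, neg_neg, norm_neg] at h1
  have hdl : ‖d‖ ≤ 2 * N * ‖y' - y‖ := by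
    have := inverse_lipschitz hN hNε hG (Gs y') (Gs y)
    rwa [hGs, hGs] at this
  have hds : ‖d - s‖ ≤ N * ε * (2 * N * ‖y' - y‖) := by
    have := inverse_near_linear hN hG (Gs y') (Gs y)
    rw [hGs, hGs] at this
    exact this.trans (mul_le_mul_of_nonneg_left hdl (by positivity))
  have hsl : ‖s‖ ≤ N * ‖y' - y‖ :=
    (H.symm : (Fin m → ℝ) →L[ℝ] (Fin m → ℝ)).le_of_opNorm_le hN _
  have h2 : |Q d d - Q s s| ≤ 6 * ‖Q‖ * N ^ 3 * ε * ‖y' - y‖ ^ 2 := by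
    have e3 : Q d d - Q s s = Q (d - s) d + Q s (d - s) := by
      simp only [map_sub, sub_apply]; ring
    rw [e3]
    calc _ ≤ |Q (d - s) d| + |Q s (d - s)| := abs_add_le _ _
      _ ≤ ‖Q‖ * ‖d - s‖ * ‖d‖ + ‖Q‖ * ‖s‖ * ‖d - s‖ :=
        add_le_add (Q.le_opNorm₂ _ _) (Q.le_opNorm₂ _ _)
      _ ≤ ‖Q‖ * (N * ε * (2 * N * ‖y' - y‖)) * (2 * N * ‖y' - y‖) +
          ‖Q‖ * (N * ‖y' - y‖) * (N * ε * (2 * N * ‖y' - y‖)) := by gcongr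
      _ = _ := by ring
  have h3 : ε * ‖d‖ ^ 2 ≤ ε * (2 * N * ‖y' - y‖) ^ 2 := by gcongr
  rw [dualForm_apply]
  rw [abs_le] at *
  constructor <;> nlinarith

end Dual

lemma hess_apply {F : (Fin m → ℝ) → ℝ} {z : Fin m → ℝ} (hF : ContDiffAt ℝ 2 F z) (i j : Fin m) :
    hess F z i j = fderiv ℝ (fderiv ℝ F) z (Pi.single i 1) (Pi.single j 1) := by
  have hdF : DifferentiableAt ℝ (fderiv ℝ F) z :=
    (hF.fderiv_right (m := 1) (by norm_num)).differentiableAt (by simp)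
  simp only [hess, Matrix.of_apply]
  rw [fderiv_clm_apply hdF (differentiableAt_const _)]
  simp

/-- A function with nondegenerate Hessian at a point agrees near that point with a member of a
dual pair. -/
theorem exists_dualPair (hm : 1 ≤ m) {F : (Fin m → ℝ) → ℝ} {z₀ : Fin m → ℝ}
    (hF : ContDiffAt ℝ 2 F z₀) (hdet : (hess F z₀).det ≠ 0) :
    ∃ r > 0, ∃ L c : ℝ, 1 ≤ L ∧ 0 < c ∧ ∃ f fs G Gs, DualPair (m := m) L c f fs G Gs ∧
      ∀ x ∈ Metric.ball z₀ r, f x = F x := by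
  have : Nonempty (Fin m) := ⟨⟨0, hm⟩⟩
  set Q := fderiv ℝ (fderiv ℝ F) z₀ with hQdef
  have hQ : ∀ v w, Q v w = Q w v := hF.isSymmSndFDerivAt (by simp)
  have hhess := hess_apply hF
  let H₀ : (Fin m → ℝ) →L[ℝ] (Fin m → ℝ) := ContinuousLinearMap.pi fun i => Q.flip (Pi.single i 1)
  have hH₀ : ∀ v i, H₀ v i = Q v (Pi.single i 1) := fun v i => rfl
  have hinj : Function.Injective H₀ := by
    rw [injective_iff_map_eq_zero]
    intro v hv
    have hv' : (hess F z₀).mulVec v = 0 := by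
      ext i
      rw [← congrFun hv i, hH₀, hQ, clm_apply_eq_sum (Q _) v]
      simp [Matrix.mulVec, dotProduct, hhess, hQdef]
    exact Matrix.eq_zero_of_mulVec_eq_zero hdet hv'
  let H : (Fin m → ℝ) ≃L[ℝ] (Fin m → ℝ) :=
    (LinearEquiv.ofInjectiveEndo (H₀ : (Fin m → ℝ) →ₗ[ℝ] (Fin m → ℝ)) hinj).toContinuousLinearEquiv
  have hH : ∀ v, H v = H₀ v := fun v => rfl
  set Qs := dualForm Q H with hQs
  have hQs_symm : ∀ v w, Qs v w = Qs w v := fun v w => by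
    rw [hQs, dualForm_apply, dualForm_apply, hQ]
  have hQ0 : Q ≠ 0 := by
    intro h0
    have hz : H₀ (fun _ => 1) = 0 := by ext i; rw [hH₀, h0]; rfl
    have := hinj (hz.trans (map_zero H₀).symm)
    exact one_ne_zero (congrFun this ⟨0, hm⟩)
  have hQs0 : Qs ≠ 0 := by
    intro h0
    apply hQ0
    ext v w
    have : Qs (H v) (H w) = 0 := by rw [h0]; rfl
    rwa [hQs, dualForm_apply, H.symm_apply_apply, H.symm_apply_apply] at this
  obtain ⟨e, he, hQe⟩ := exists_int_quadratic_ne_zero hQ hQ0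
  obtain ⟨es, hes, hQes⟩ := exists_int_quadratic_ne_zero hQs_symm hQs0
  set δ := |Q (fun i => e i) (fun i => e i)|
  set δs := |Qs (fun i => es i) (fun i => es i)|
  have hδ : 0 < δ := abs_pos.mpr hQe
  have hδs : 0 < δs := abs_pos.mpr hQes
  set N := ‖(H.symm : (Fin m → ℝ) →L[ℝ] (Fin m → ℝ))‖ with hN
  have hN0 : 0 ≤ N := norm_nonneg _
  set K := 4 * N ^ 2 + 3 * ‖Q‖ * N ^ 3 with hK
  have hK0 : 0 ≤ K := by positivity
  obtain ⟨ε, hε, hε1, hε2, hε3⟩ : ∃ ε > 0, N * ε < 1 / 2 ∧ ε ≤ δ / 4 ∧ K * ε ≤ δs / 4 := by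
    refine ⟨min (1 / (4 * (N + 1))) (min (δ / 4) (δs / (4 * (K + 1)))), by positivity, ?_, ?_, ?_⟩
    · have h1 := min_le_left (1 / (4 * (N + 1))) (min (δ / 4) (δs / (4 * (K + 1))))
      have h2 : N * (1 / (4 * (N + 1))) < 1 / 2 := by
        rw [mul_one_div, div_lt_div_iff₀ (by positivity) (by positivity)]; linarith
      nlinarith
    · exact (min_le_right _ _).trans (min_le_left _ _)
    · have h1 := (min_le_right (1 / (4 * (N + 1))) _).trans
        (min_le_right (δ / 4) (δs / (4 * (K + 1))))
      have h2 : K * (δs / (4 * (K + 1))) ≤ δs / 4 := by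
        rw [← mul_div_assoc, div_le_div_iff₀ (by positivity) (by positivity)]; nlinarith
      nlinarith
  obtain ⟨r, hr, f, Df, hDf, hl, hfF⟩ := exists_extension hF hε
  let G : (Fin m → ℝ) → (Fin m → ℝ) := fun x i => Df x (Pi.single i 1)
  have hA : ∀ x x', |f x' - f x - ∑ i, G x i * (x' i - x i) - 1 / 2 * Q (x' - x) (x' - x)| ≤
      ε * ‖x' - x‖ ^ 2 := by
    intro x x'
    have := abs_sub_quadratic_le hQ hε.le hDf hl x x'
    rwa [clm_apply_eq_sum (Df x)] at this
  have hG : ∀ x x', ‖G x - G x' - H (x - x')‖ ≤ ε * ‖x - x'‖ := by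
    intro x x'
    rw [pi_norm_le_iff_of_nonneg (by positivity)]
    intro i
    have := (Df x - Df x' - Q (x - x')).le_of_opNorm_le (hl x x') (Pi.single i 1)
    simpa [G, hH, hH₀, Pi.norm_single] using this
  have hGinj : Function.Injective G := by
    intro x x' hxx
    have := inverse_lipschitz hN.ge hε1.le hG x x'
    rw [hxx, sub_self, norm_zero, mul_zero, norm_le_zero_iff, sub_eq_zero] at this
    exact this
  have hGsurj : Function.Surjective G := by
    have happ : ApproximatesLinearOn G (H : (Fin m → ℝ) →L[ℝ] (Fin m → ℝ)) Set.univ ε.toNNReal :=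
      fun x _ x' _ => by
        rw [Real.coe_toNNReal _ hε.le]; exact hG x x'
    refine happ.surjective (Or.inr ?_)
    have hNpos : 0 < N := by
      rw [hN]; exact H.symm.norm_pos
    rw [← NNReal.coe_lt_coe]
    rw [NNReal.coe_inv, coe_nnnorm, ← hN, Real.coe_toNNReal _ hε.le, ← one_div, lt_div_iff₀ hNpos]
    linarith
  let Gs := Function.surjInv hGsurj
  have hGGs : ∀ y, G (Gs y) = y := Function.surjInv_eq hGsurj
  have hGsG : ∀ x, Gs (G x) = x := fun x => hGinj (hGGs (G x))
  let fs : (Fin m → ℝ) → ℝ := fun y => ∑ i, Gs y i * y i - f (Gs y)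
  have hB := dual_quadratic hε.le hN.ge hε1.le hG hGGs hA (fs := fs) fun y => rfl
  set A := ‖(H : (Fin m → ℝ) →L[ℝ] (Fin m → ℝ))‖
  have hA0 : 0 ≤ A := norm_nonneg _
  have hQn : 0 ≤ ‖Q‖ := Q.opNorm_nonneg
  have hQsn : 0 ≤ ‖Qs‖ := Qs.opNorm_nonneg
  have hKε : 0 ≤ K * ε := by positivity
  set L := 1 + A + ε + 2 * N + ‖Q‖ + ‖Qs‖ + K * ε with hL
  refine ⟨r, hr, L, min δ δs / 4, by linarith, by positivity, f, fs, G, Gs, ⟨?_, ?_⟩, hfF⟩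
  · refine ⟨hGsG, fun x => ?_, fun x x' => ?_, fun x x' => ?_, conv_of_quadratic hε.le hA he ?_⟩
    · simp only [fs, hGsG]
      rw [add_sub_cancel]
      exact Finset.sum_congr rfl fun i _ => mul_comm _ _
    · exact (lipschitz_of_near_linear hG x x').trans
        (mul_le_mul_of_nonneg_right (by linarith) (norm_nonneg _))
    · exact (taylor_of_quadratic hA x x').trans
        (mul_le_mul_of_nonneg_right (by linarith) (by positivity))
    · have := min_le_left δ δs
      change min δ δs / 4 + ε ≤ δ / 2
      linarith
  · refine ⟨hGGs, fun y => ?_, fun y y' => ?_, fun y y' => ?_, conv_of_quadratic hKε hB hes ?_⟩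
    · simp only [fs]; ring
    · have := inverse_lipschitz hN.ge hε1.le hG (Gs y) (Gs y')
      rw [hGGs, hGGs] at this
      exact this.trans (mul_le_mul_of_nonneg_right (by linarith) (norm_nonneg _))
    · exact (taylor_of_quadratic hB y y').trans
        (mul_le_mul_of_nonneg_right (by linarith) (by positivity))
    · have := min_le_right δ δs
      change min δ δs / 4 + K * ε ≤ δs / 2
      linarith

end QuadraticPair

/-- A nonempty open set stable under scaling by positive integers contains an integer point. -/
lemma exists_int_mem_of_isOpen {ι : Type*} [Fintype ι] {S : Set (ι → ℝ)} (hS : IsOpen S)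
    (hne : S.Nonempty) (hsc : ∀ v ∈ S, ∀ k : ℕ, 0 < k → (k : ℝ) • v ∈ S) :
    ∃ k : ι → ℤ, (fun i => (k i : ℝ)) ∈ S := by
  obtain ⟨v, hv⟩ := hne
  obtain ⟨ε, hε, hb⟩ := Metric.isOpen_iff.mp hS v hv
  obtain ⟨N, hN⟩ := exists_nat_gt (1 / ε)
  have hN0 : (0 : ℝ) < N := lt_trans (by positivity) hN
  have hmem : (fun i => (round (N * v i) : ℝ) / N) ∈ S := by
    apply hb
    rw [Metric.mem_ball, dist_pi_lt_iff hε]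
    intro i
    have h1 := abs_sub_round (N * v i)
    have h2 : (round (N * v i) : ℝ) / N - v i = -(N * v i - round (N * v i)) / N := by
      field_simp; ring
    rw [Real.dist_eq, h2, abs_div, abs_neg, abs_of_pos hN0, div_lt_iff₀ hN0]
    have : 1 < ε * N := by rwa [div_lt_iff₀ hε, mul_comm] at hN
    linarith
  refine ⟨fun i => round (N * v i), ?_⟩
  have := hsc _ hmem N (by exact_mod_cast hN0)
  convert this using 2 with i
  rw [Pi.smul_apply, smul_eq_mul]
  field_simp

section Hessian
variable {m : ℕ}

lemma hess_det_ne_zero_iff {F : (Fin m → ℝ) → ℝ} {z : Fin m → ℝ} (hF : ContDiffAt ℝ 2 F z) :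
    (hess F z).det ≠ 0 ↔ ∀ v, (∀ w, fderiv ℝ (fderiv ℝ F) z v w = 0) → v = 0 := by
  have hsymm : ∀ v w, fderiv ℝ (fderiv ℝ F) z v w = fderiv ℝ (fderiv ℝ F) z w v :=
    hF.isSymmSndFDerivAt (by simp)
  have hmul : ∀ v i, (hess F z).mulVec v i = fderiv ℝ (fderiv ℝ F) z v (Pi.single i 1) := by
    intro v i
    rw [hsymm, clm_apply_eq_sum (fderiv ℝ (fderiv ℝ F) z _) v]
    simp [Matrix.mulVec, dotProduct, hess_apply hF]
  constructor
  · intro h v hv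
    refine Matrix.eq_zero_of_mulVec_eq_zero h ?_
    ext i
    rw [hmul, hv]; rfl
  · intro h hdet
    obtain ⟨v, hv, hv0⟩ := Matrix.exists_mulVec_eq_zero_iff.mpr hdet
    refine hv (h v fun w => ?_)
    rw [clm_apply_eq_sum (fderiv ℝ (fderiv ℝ F) z v) w]
    refine Finset.sum_eq_zero fun i _ => ?_
    rw [← hmul, hv0]; simp

lemma hess_sum {ι : Type*} [Fintype ι] {Ψ : (Fin m → ℝ) → ι → ℝ} {z : Fin m → ℝ}
    (hΨ : ContDiffAt ℝ 2 Ψ z) (w : ι → ℝ) :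
    hess (fun y => ∑ i, w i * Ψ y i) z = ∑ i, w i • hess (fun y => Ψ y i) z := by
  have hi : ∀ i, ContDiffAt ℝ 2 (fun y => Ψ y i) z := contDiffAt_pi.mp hΨ
  have hs : ContDiffAt ℝ 2 (fun y => ∑ i, w i * Ψ y i) z :=
    ContDiffAt.sum fun i _ => contDiffAt_const.mul (hi i)
  have h1 : fderiv ℝ (fun y => ∑ i, w i * Ψ y i) =ᶠ[nhds z]
      fun y => ∑ i, w i • fderiv ℝ (fun y => Ψ y i) y := by
    filter_upwards [hΨ.eventually (by simp)] with y hy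
    have hd : ∀ i, DifferentiableAt ℝ (fun y => Ψ y i) y := fun i =>
      (contDiffAt_pi.mp hy i).differentiableAt (by simp)
    exact (HasFDerivAt.fun_sum fun i _ => (hd i).hasFDerivAt.const_mul (w i)).fderiv
  have h2 : ∀ i, DifferentiableAt ℝ (fderiv ℝ fun y => Ψ y i) z := fun i =>
    ((hi i).fderiv_right (m := 1) (by norm_num)).differentiableAt (by simp)
  have h3 : fderiv ℝ (fderiv ℝ (fun y => ∑ i, w i * Ψ y i)) z =
      ∑ i, w i • fderiv ℝ (fderiv ℝ fun y => Ψ y i) z := by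
    rw [h1.fderiv_eq]
    exact (HasFDerivAt.fun_sum fun i _ => (h2 i).hasFDerivAt.const_smul (w i)).fderiv
  ext a b
  rw [hess_apply hs, h3, Matrix.sum_apply]
  simp [hess_apply (hi _)]

lemma hess_comp_det_ne_zero {h : (Fin m → ℝ) → ℝ} {θ : (Fin m → ℝ) → (Fin m → ℝ)} {z : Fin m → ℝ}
    {T : (Fin m → ℝ) ≃L[ℝ] (Fin m → ℝ)} (hh : ContDiffAt ℝ 2 h (θ z)) (hθ : ContDiffAt ℝ 2 θ z)
    (hT : HasFDerivAt θ (T : (Fin m → ℝ) →L[ℝ] (Fin m → ℝ)) z) (h0 : fderiv ℝ h (θ z) = 0)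
    (hdet : (hess h (θ z)).det ≠ 0) : (hess (fun y => h (θ y)) z).det ≠ 0 := by
  have hc : ContDiffAt ℝ 2 (fun y => h (θ y)) z := hh.comp z hθ
  rw [hess_det_ne_zero_iff hh] at hdet
  rw [hess_det_ne_zero_iff hc]
  have h1 : fderiv ℝ (fun y => h (θ y)) =ᶠ[nhds z]
      fun y => (fderiv ℝ h (θ y)).comp (fderiv ℝ θ y) := by
    filter_upwards [hθ.eventually (by simp), hθ.continuousAt.eventually (hh.eventually (by simp))]
      with y hy hy'
    exact ((hy'.differentiableAt (by simp)).hasFDerivAt.comp y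
      (hy.differentiableAt (by simp)).hasFDerivAt).fderiv
  have h2 : HasFDerivAt (fderiv ℝ h) (fderiv ℝ (fderiv ℝ h) (θ z)) (θ z) :=
    ((hh.fderiv_right (m := 1) (by norm_num)).differentiableAt (by simp)).hasFDerivAt
  have h3 : HasFDerivAt (fderiv ℝ θ) (fderiv ℝ (fderiv ℝ θ) z) z :=
    ((hθ.fderiv_right (m := 1) (by norm_num)).differentiableAt (by simp)).hasFDerivAt
  have h4 : ∀ v w, fderiv ℝ (fderiv ℝ (fun y => h (θ y))) z v w =
      fderiv ℝ (fderiv ℝ h) (θ z) (T v) (T w) := by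
    intro v w
    have hc : HasFDerivAt (fun y => (fderiv ℝ h (θ y)).comp (fderiv ℝ θ y)) _ z :=
      (h2.comp z hT).clm_comp h3
    rw [h1.fderiv_eq, hc.fderiv]
    simp [h0, hT.fderiv]
  intro v hv
  have : T v = 0 := hdet _ fun w => by
    rw [← T.apply_symm_apply w, ← h4, hv]
  exact (map_eq_zero_iff T T.injective).mp this

/-- A parametrized piece with a nondegenerate critical linear functional has an integral projection
to the graph of a function with nondegenerate Hessian. -/
lemma exists_int_projection {n : ℕ} {Φ : (Fin m → ℝ) → (Fin n → ℝ)} {y₀ : Fin m → ℝ}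
    (hΦ : ContDiffAt ℝ 2 Φ y₀) {A : Matrix (Fin m) (Fin n) ℝ} (hA : ∀ y, A.mulVec (Φ y) = y)
    {η : Fin n → ℝ} (hη : fderiv ℝ (fun y => ∑ i, η i * Φ y i) y₀ = 0)
    (hdet : (hess (fun y => ∑ i, η i * Φ y i) y₀).det ≠ 0) :
    ∃ (M : Fin m → Fin n → ℤ) (w : Fin n → ℤ) (F : (Fin m → ℝ) → ℝ),
      ContDiffAt ℝ 2 F (fun k => ∑ i, (M k i : ℝ) * Φ y₀ i) ∧
      (hess F (fun k => ∑ i, (M k i : ℝ) * Φ y₀ i)).det ≠ 0 ∧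
      (∀ᶠ y in nhds y₀, F (fun k => ∑ i, (M k i : ℝ) * Φ y i) = ∑ i, (w i : ℝ) * Φ y i) ∧
      ∃ θ : (Fin m → ℝ) → (Fin m → ℝ), ∀ᶠ y in nhds y₀, θ (fun k => ∑ i, (M k i : ℝ) * Φ y i) = y := by
  have hΦd : HasFDerivAt Φ (fderiv ℝ Φ y₀) y₀ := (hΦ.differentiableAt (by simp)).hasFDerivAt
  set D := fderiv ℝ Φ y₀
  let J : Matrix (Fin n) (Fin m) ℝ := Matrix.of fun i k => D (Pi.single k 1) i
  have hJ : ∀ v, J.mulVec v = D v := by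
    intro v
    ext i
    have := clm_apply_eq_sum ((ContinuousLinearMap.proj i).comp D) v
    simp only [ContinuousLinearMap.comp_apply, ContinuousLinearMap.proj_apply] at this
    rw [this]; rfl
  have hg : ∀ B : Matrix (Fin m) (Fin n) ℝ, HasFDerivAt (fun y => B.mulVec (Φ y))
      ((LinearMap.toContinuousLinearMap B.mulVecLin).comp D) y₀ := fun B =>
    (LinearMap.toContinuousLinearMap B.mulVecLin).hasFDerivAt.comp y₀ hΦd
  have hAJ : A * J = 1 := by
    have h1 := hg A
    simp only [hA] at h1
    have h2 := h1.unique (hasFDerivAt_id y₀)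
    refine Matrix.ext_of_mulVec_single fun k => ?_
    rw [← Matrix.mulVec_mulVec, hJ, Matrix.one_mulVec]
    exact DFunLike.congr_fun h2 (Pi.single k 1)
  obtain ⟨M', hM'⟩ : ∃ k : Fin m × Fin n → ℤ, (fun i => (k i : ℝ)) ∈
      {v : Fin m × Fin n → ℝ | (Matrix.of (fun i j => v (i, j)) * J).det ≠ 0} := by
    refine exists_int_mem_of_isOpen ?_ ⟨fun p => A p.1 p.2, ?_⟩ fun v hv k hk => ?_
    · refine isOpen_ne.preimage (Continuous.matrix_det (Continuous.matrix_mul ?_ continuous_const))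
      exact continuous_matrix fun i j => continuous_apply (i, j)
    · change (A * J).det ≠ 0
      rw [hAJ, Matrix.det_one]; exact one_ne_zero
    · have : (Matrix.of fun i j => ((k : ℝ) • v) (i, j)) * J =
          (k : ℝ) • ((Matrix.of fun i j => v (i, j)) * J) := by
        rw [← Matrix.smul_mul]; rfl
      change (Matrix.of (fun i j => ((k : ℝ) • v) (i, j)) * J).det ≠ 0
      rw [this, Matrix.det_smul]
      exact mul_ne_zero (pow_ne_zero _ (by exact_mod_cast hk.ne')) hv
  set M : Fin m → Fin n → ℤ := fun k i => M' (k, i) with hM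
  let MR : Matrix (Fin m) (Fin n) ℝ := Matrix.of fun k i => (M k i : ℝ)
  have hMJ : (MR * J).det ≠ 0 := hM'
  set g : (Fin m → ℝ) → (Fin m → ℝ) := fun y => MR.mulVec (Φ y) with hgdef
  have hgs : ContDiffAt ℝ 2 g y₀ :=
    (LinearMap.toContinuousLinearMap MR.mulVecLin).contDiff.contDiffAt.comp y₀ hΦ
  have hinj : Function.Injective ((LinearMap.toContinuousLinearMap MR.mulVecLin).comp D) := by
    rw [injective_iff_map_eq_zero]
    intro v hv
    refine Matrix.eq_zero_of_mulVec_eq_zero hMJ ?_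
    rw [← Matrix.mulVec_mulVec, hJ]
    exact hv
  let T : (Fin m → ℝ) ≃L[ℝ] (Fin m → ℝ) := (LinearEquiv.ofInjectiveEndo
    (((LinearMap.toContinuousLinearMap MR.mulVecLin).comp D : _ →L[ℝ] _) :
      (Fin m → ℝ) →ₗ[ℝ] (Fin m → ℝ)) hinj).toContinuousLinearEquiv
  have hgT : HasFDerivAt g (T : (Fin m → ℝ) →L[ℝ] (Fin m → ℝ)) y₀ := hg MR
  have hgst := hgs.hasStrictFDerivAt' hgT (by simp)
  set θ := hgst.localInverse with hθdef
  have hθs : ContDiffAt ℝ 2 θ (g y₀) := hgs.to_localInverse hgT (by simp)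
  have hθT := hgst.to_localInverse.hasFDerivAt
  have hθ0 : θ (g y₀) = y₀ := hgst.localInverse_apply_image
  have hθl : ∀ᶠ y in nhds y₀, θ (g y) = y := hgst.eventually_left_inverse
  have hΨ : ContDiffAt ℝ 2 (fun z => Φ (θ z)) (g y₀) := by
    refine ContDiffAt.comp (g y₀) ?_ hθs
    rwa [hθ0]
  have hηdet : (hess (fun z => ∑ i, η i * Φ (θ z) i) (g y₀)).det ≠ 0 := by
    refine hess_comp_det_ne_zero (h := fun y => ∑ i, η i * Φ y i) ?_ hθs hθT ?_ ?_
    · rw [hθ0]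
      exact ContDiffAt.sum fun i _ => contDiffAt_const.mul (contDiffAt_pi.mp hΦ i)
    · rwa [hθ0]
    · rwa [hθ0]
  obtain ⟨w, hw⟩ : ∃ k : Fin n → ℤ, (fun i => (k i : ℝ)) ∈
      {v : Fin n → ℝ | (∑ i, v i • hess (fun z => Φ (θ z) i) (g y₀)).det ≠ 0} := by
    refine exists_int_mem_of_isOpen ?_ ⟨η, ?_⟩ fun v hv k hk => ?_
    · refine isOpen_ne.preimage (Continuous.matrix_det ?_)
      exact continuous_finsetSum _ fun i _ => (continuous_apply i).smul continuous_const
    · rwa [hess_sum hΨ] at hηdet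
    · have : ∑ i, ((k : ℝ) • v) i • hess (fun z => Φ (θ z) i) (g y₀) =
          (k : ℝ) • ∑ i, v i • hess (fun z => Φ (θ z) i) (g y₀) := by
        rw [Finset.smul_sum]
        exact Finset.sum_congr rfl fun i _ => by rw [smul_smul]; rfl
      change Matrix.det _ ≠ 0
      rw [this, Matrix.det_smul]
      exact mul_ne_zero (pow_ne_zero _ (by exact_mod_cast hk.ne')) hv
  refine ⟨M, w, fun z => ∑ i, (w i : ℝ) * Φ (θ z) i, ?_, ?_, ?_, θ, hθl⟩
  · exact ContDiffAt.sum fun i _ => contDiffAt_const.mul (contDiffAt_pi.mp hΨ i)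
  · have := hess_sum hΨ fun i => (w i : ℝ)
    change (hess (fun z => ∑ i, (w i : ℝ) * Φ (θ z) i) (g y₀)).det ≠ 0
    rw [this]
    exact hw
  · filter_upwards [hθl] with y hy
    change ∑ i, (w i : ℝ) * Φ (θ (g y)) i = _
    rw [hy]

end Hessian

section Chart
variable {n m : ℕ}

lemma sum_appendV2_mul (hmn : m ≤ n) (a y : Fin m → ℝ) (b z : Fin (n - m) → ℝ) :
    ∑ i, appendV2 n m a b i * appendV2 n m y z i = ∑ k, a k * y k + ∑ j, b j * z j := by
  have h := Fintype.sum_sum_type (Sum.elim (fun k => a k * y k) fun j => b j * z j)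
  simp only [Sum.elim_inl, Sum.elim_inr] at h
  rw [← h]
  symm
  refine Fintype.sum_equiv (finSumFinEquiv.trans (finCongr (by omega : m + (n - m) = n))) _ _
    fun s => ?_
  rcases s with k | j
  · simp [appendV2]
  · simp [appendV2]

lemma contDiffAt_appendV2 {f : (Fin m → ℝ) → (Fin (n - m) → ℝ)} {y₀ : Fin m → ℝ}
    (hf : ContDiffAt ℝ 2 f y₀) : ContDiffAt ℝ 2 (fun y => appendV2 n m y (f y)) y₀ := by
  rw [contDiffAt_pi]
  intro i
  unfold appendV2
  by_cases h : (i : ℕ) < m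
  · simp only [h, dite_true]
    exact contDiffAt_pi.mp contDiffAt_id _
  · simp only [h, dite_false]
    exact contDiffAt_pi.mp hf _

lemma hess_sub_linear {φ : (Fin m → ℝ) → ℝ} {y₀ : Fin m → ℝ} (hφ : ContDiffAt ℝ 2 φ y₀)
    (ℓ : (Fin m → ℝ) →L[ℝ] ℝ) : hess (fun y => φ y - ℓ y) y₀ = hess φ y₀ := by
  ext i j
  simp only [hess, Matrix.of_apply]
  have h1 : (fun y => fderiv ℝ (fun y => φ y - ℓ y) y (Pi.single j 1)) =ᶠ[nhds y₀]
      fun y => fderiv ℝ φ y (Pi.single j 1) - ℓ (Pi.single j 1) := by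
    filter_upwards [hφ.eventually (by simp)] with y hy
    have h : HasFDerivAt (fun y => φ y - ℓ y) (fderiv ℝ φ y - ℓ) y :=
      (hy.differentiableAt (by simp)).hasFDerivAt.sub ℓ.hasFDerivAt
    rw [h.fderiv]
    rfl
  rw [h1.fderiv_eq, fderiv_sub_const]

/-- Near a point where the second fundamental form is nondegenerate, the rational points of
a graph are controlled by `countBound`. -/
lemma exists_nhds_card_le (hm : 1 ≤ m) (hmn : m < n) {X : Set (Fin n → ℝ)} {x : Fin n → ℝ}
    {O : Matrix (Fin n) (Fin n) ℝ} (hO : O ∈ Matrix.orthogonalGroup (Fin n) ℝ)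
    {U : Set (Fin m → ℝ)} {f : (Fin m → ℝ) → (Fin (n - m) → ℝ)}
    {y₀ : Fin m → ℝ} (hf : ContDiffAt ℝ 2 f y₀) (hx : x = O.mulVec (appendV2 n m y₀ (f y₀)))
    {ε : ℝ} (hε : 0 < ε) (hball : X ∩ Metric.ball x ε =
      (O.mulVec '' {p | ∃ y ∈ U, p = appendV2 n m y (f y)}) ∩ Metric.ball x ε)
    {u : Fin (n - m) → ℝ} (hu : (hess (fun y => ∑ i, u i * f y i) y₀).det ≠ 0) :
    ∃ V ∈ nhds x, ∃ C > 0, ∃ c > 0, ∀ (B : ℝ) (T : Finset ((Fin n → ℤ) × ℤ)), 2 ≤ B →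
      (∀ p ∈ T, 1 ≤ p.2 ∧ (p.2 : ℝ) ≤ B ∧ (fun i => (p.1 i : ℝ) / (p.2 : ℝ)) ∈ X ∩ V) →
      (T.card : ℝ) ≤ C * countBound m c B := by
  classical
  set Φ : (Fin m → ℝ) → (Fin n → ℝ) := fun y => O.mulVec (appendV2 n m y (f y)) with hΦdef
  have hOO : O.transpose * O = 1 := hO.1
  let A : Matrix (Fin m) (Fin n) ℝ := Matrix.of fun k i => O i (Fin.castLE hmn.le k)
  have hA : ∀ y, A.mulVec (Φ y) = y := by
    intro y
    ext k
    change O.transpose.mulVec (Φ y) (Fin.castLE hmn.le k) = y k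
    simp only [hΦdef]
    rw [Matrix.mulVec_mulVec, hOO, Matrix.one_mulVec]
    simp [appendV2]
  have hΦs : ContDiffAt ℝ 2 Φ y₀ :=
    (LinearMap.toContinuousLinearMap O.mulVecLin).contDiff.contDiffAt.comp y₀
      (contDiffAt_appendV2 hf)
  set φ : (Fin m → ℝ) → ℝ := fun y => ∑ i, u i * f y i with hφdef
  have hφs : ContDiffAt ℝ 2 φ y₀ :=
    ContDiffAt.sum fun i _ => contDiffAt_const.mul (contDiffAt_pi.mp hf i)
  set ℓ := fderiv ℝ φ y₀ with hℓ
  set η : Fin n → ℝ := O.mulVec (appendV2 n m (fun k => -ℓ (Pi.single k 1)) u) with hηdef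
  have hη : (fun y => ∑ i, η i * Φ y i) = fun y => φ y - ℓ y := by
    funext y
    have h1 : ∑ i, η i * Φ y i = ∑ i, appendV2 n m (fun k => -ℓ (Pi.single k 1)) u i *
        appendV2 n m y (f y) i := by
      change η ⬝ᵥ Φ y = appendV2 n m (fun k => -ℓ (Pi.single k 1)) u ⬝ᵥ appendV2 n m y (f y)
      simp only [hΦdef, hηdef]
      rw [Matrix.dotProduct_mulVec, ← Matrix.mulVec_transpose, Matrix.mulVec_mulVec, hOO,
        Matrix.one_mulVec]
    rw [h1, sum_appendV2_mul hmn.le, clm_apply_eq_sum ℓ y]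
    simp only [neg_mul, Finset.sum_neg_distrib, hφdef]
    ring
  have hη1 : fderiv ℝ (fun y => ∑ i, η i * Φ y i) y₀ = 0 := by
    have h : HasFDerivAt (fun y => φ y - ℓ y) (fderiv ℝ φ y₀ - ℓ) y₀ :=
      (hφs.differentiableAt (by simp)).hasFDerivAt.sub ℓ.hasFDerivAt
    rw [hη, h.fderiv, hℓ, sub_self]
  have hη2 : (hess (fun y => ∑ i, η i * Φ y i) y₀).det ≠ 0 := by
    rwa [hη, hess_sub_linear hφs]
  obtain ⟨M, w, F, hFs, hFdet, hFw, θ, hθ⟩ := exists_int_projection hΦs hA hη1 hη2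
  let P : (Fin n → ℝ) → (Fin m → ℝ) := fun p k => ∑ i, (M k i : ℝ) * p i
  have hPc : Continuous P := by fun_prop
  obtain ⟨r, hr, L, c, hL, hc, f', fs, G, Gs, hdual, hf'⟩ := exists_dualPair hm hFs hFdet
  obtain ⟨C, hC, c', hc', hcount⟩ := card_onGraph_le_countBound m hm hL hc
  have hΦ0 : Φ y₀ = x := hx.symm
  have hAc : Filter.Tendsto A.mulVec (nhds x) (nhds y₀) := by
    have : Continuous A.mulVec := continuous_const.matrix_mulVec continuous_id
    have h := this.tendsto x
    rwa [← hΦ0, hA, hΦ0] at h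
  have hev : ∀ᶠ p in nhds x, p ∈ X → p = Φ (A.mulVec p) ∧ θ (P p) = A.mulVec p ∧
      F (P p) = ∑ i, (w i : ℝ) * p i ∧ P p ∈ Metric.ball (P x) (min r 1) := by
    filter_upwards [Metric.ball_mem_nhds x hε, hAc.eventually (hFw.and hθ),
      hPc.continuousAt.eventually (Metric.ball_mem_nhds (P x) (lt_min hr one_pos))]
      with p hp1 hp2 hp3 hpX
    have hmem : p ∈ X ∩ Metric.ball x ε := ⟨hpX, hp1⟩
    rw [hball] at hmem
    obtain ⟨⟨_, ⟨y, -, rfl⟩, hy⟩, -⟩ := hmem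
    have hpΦ : p = Φ (A.mulVec p) := by
      rw [← hy]; exact congrArg Φ (hA y).symm
    rw [← hpΦ] at hp2
    exact ⟨hpΦ, hp2.2, hp2.1, hp3⟩
  refine ⟨_, hev, C, hC, c', hc', fun B T hB hT => ?_⟩
  let j : (Fin n → ℤ) × ℤ → ℤ × (Fin m → ℤ) × ℤ := fun p =>
    (p.2, (fun k => ∑ i, M k i * p.1 i), ∑ i, w i * p.1 i)
  have hjP : ∀ p : (Fin n → ℤ) × ℤ, (fun k => ((j p).2.1 k : ℝ) / (j p).1) =
      P fun i => (p.1 i : ℝ) / (p.2 : ℝ) := by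
    intro p
    funext k
    simp only [j, P]
    push_cast
    rw [Finset.sum_div]
    exact Finset.sum_congr rfl fun i _ => mul_div_assoc _ _ _
  have hq : ∀ p ∈ T, (p.2 : ℝ) ≠ 0 := fun p hp => by
    have := (hT p hp).1
    exact_mod_cast (by omega : p.2 ≠ 0)
  have hinj : Set.InjOn j T := by
    intro p hp p' hp' hpp
    have hpt := (hT p hp).2.2.2 (hT p hp).2.2.1
    have hpt' := (hT p' hp').2.2.2 (hT p' hp').2.2.1
    have e1 : P (fun i => (p.1 i : ℝ) / (p.2 : ℝ)) = P fun i => (p'.1 i : ℝ) / (p'.2 : ℝ) := by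
      rw [← hjP, ← hjP, hpp]
    have e2 : (fun i => (p.1 i : ℝ) / (p.2 : ℝ)) = fun i => (p'.1 i : ℝ) / (p'.2 : ℝ) := by
      rw [hpt.1, hpt'.1, ← hpt.2.1, ← hpt'.2.1, e1]
    have e3 : p.2 = p'.2 := congrArg Prod.fst hpp
    refine Prod.ext (funext fun i => ?_) e3
    have e4 := congrFun e2 i
    simp only [e3] at e4
    have := (div_left_inj' (hq p' hp')).mp e4
    exact_mod_cast this
  rw [← Finset.card_image_of_injOn hinj]
  refine hcount f' fs G Gs hdual B (P x) _ hB fun p' hp' => ?_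
  obtain ⟨p, hp, rfl⟩ := Finset.mem_image.mp hp'
  obtain ⟨h1, h2, hX', hV⟩ := hT p hp
  obtain ⟨-, -, h3, h4⟩ := hV hX'
  have hPr : P (fun i => (p.1 i : ℝ) / (p.2 : ℝ)) ∈ Metric.ball (P x) r :=
    Metric.ball_subset_ball (min_le_left _ _) h4
  refine ⟨⟨h1, h2⟩, fun k => ?_, ?_⟩
  · have h5 := (dist_pi_lt_iff (lt_min hr one_pos)).mp h4 k
    rw [← hjP, Real.dist_eq] at h5
    exact h5.le.trans (min_le_right _ _)
  · rw [hjP]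
    have h6 : f' (P fun i => (p.1 i : ℝ) / (p.2 : ℝ)) = F (P fun i => (p.1 i : ℝ) / (p.2 : ℝ)) := by
      apply hf'
      rw [← hΦ0] at hPr
      exact hPr
    rw [h6, h3]
    simp only [j]
    push_cast
    rw [Finset.mul_sum]
    refine Finset.sum_congr rfl fun i _ => ?_
    have := hq p hp
    field_simp

/-- A local counting bound on a compact set gives a global one. -/
lemma exists_NX_le_of_local {X : Set (Fin n → ℝ)} (hX : IsCompact X)
    (hloc : ∀ x ∈ X, ∃ V ∈ nhds x, ∃ C > 0, ∃ c > 0, ∀ (B : ℝ) (T : Finset ((Fin n → ℤ) × ℤ)),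
      2 ≤ B → (∀ p ∈ T, 1 ≤ p.2 ∧ (p.2 : ℝ) ≤ B ∧ (fun i => (p.1 i : ℝ) / (p.2 : ℝ)) ∈ X ∩ V) →
      (T.card : ℝ) ≤ C * countBound m c B) :
    ∃ c > 0, ∃ C > 0, ∀ B : ℝ, 2 ≤ B → (NX X B : ℝ) ≤ C * countBound m c B := by
  classical
  choose! V hV C hC c hc hbd using hloc
  obtain ⟨t, htX, ht⟩ := hX.elim_nhds_subcover V hV
  have hc0 : ∀ x ∈ t, 0 ≤ c x := fun x hx => (hc x (htX x hx)).le
  have hC0 : ∀ x ∈ t, 0 ≤ C x := fun x hx => (hC x (htX x hx)).le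
  refine ⟨∑ x ∈ t, c x + 1, by have := Finset.sum_nonneg hc0; linarith,
    ∑ x ∈ t, C x + 1, by have := Finset.sum_nonneg hC0; linarith, fun B hB => ?_⟩
  set c₀ := ∑ x ∈ t, c x + 1 with hc₀
  have hcb : 0 ≤ countBound m c₀ B := countBound_nonneg (by linarith)
  have hfin : ∀ T : Finset ((Fin n → ℤ) × ℤ), (∀ p ∈ T, 1 ≤ p.2 ∧ (p.2 : ℝ) ≤ B ∧
      (fun i => (p.1 i : ℝ) / (p.2 : ℝ)) ∈ X) →
      (T.card : ℝ) ≤ (∑ x ∈ t, C x + 1) * countBound m c₀ B := by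
    intro T hT
    have hsub : T ⊆ t.biUnion fun x => T.filter fun p =>
        (fun i => (p.1 i : ℝ) / (p.2 : ℝ)) ∈ V x := by
      intro p hp
      obtain ⟨x, hx, hpx⟩ := Set.mem_iUnion₂.mp (ht (hT p hp).2.2)
      exact Finset.mem_biUnion.mpr ⟨x, hx, Finset.mem_filter.mpr ⟨hp, hpx⟩⟩
    have h1 : (T.card : ℝ) ≤ ∑ x ∈ t, ((T.filter fun p =>
        (fun i => (p.1 i : ℝ) / (p.2 : ℝ)) ∈ V x).card : ℝ) := by
      exact_mod_cast (Finset.card_le_card hsub).trans Finset.card_biUnion_le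
    have h2 : ∀ x ∈ t, ((T.filter fun p => (fun i => (p.1 i : ℝ) / (p.2 : ℝ)) ∈ V x).card : ℝ) ≤
        C x * countBound m c₀ B := by
      intro x hx
      refine (hbd x (htX x hx) B _ hB fun p hp => ?_).trans
        (mul_le_mul_of_nonneg_left (countBound_mono ?_) (hC0 x hx))
      · obtain ⟨hpT, hpV⟩ := Finset.mem_filter.mp hp
        obtain ⟨a1, a2, a3⟩ := hT p hpT
        exact ⟨a1, a2, a3, hpV⟩
      · have := Finset.single_le_sum hc0 hx
        linarith
    calc (T.card : ℝ) ≤ _ := h1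
      _ ≤ ∑ x ∈ t, C x * countBound m c₀ B := Finset.sum_le_sum h2
      _ = (∑ x ∈ t, C x) * countBound m c₀ B := by rw [Finset.sum_mul]
      _ ≤ _ := mul_le_mul_of_nonneg_right (by linarith) hcb
  unfold NX
  set S := {p : (Fin n → ℤ) × ℤ | 1 ≤ p.2 ∧ (p.2 : ℝ) ≤ B ∧
    (fun i => (p.1 i : ℝ) / (p.2 : ℝ)) ∈ X} with hS
  by_cases hSf : S.Finite
  · have hcard := Set.ncard_eq_toFinset_card S hSf
    rw [Nat.card_coe_set_eq, hcard]
    exact hfin _ fun p hp => hSf.mem_toFinset.mp hp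
  · rw [Nat.card_coe_set_eq, Set.Infinite.ncard hSf]
    simpa using hfin ∅ (by simp)

end Chart

theorem statement4 (n m : ℕ) (hm : 1 ≤ m) (hmn : m < n)
    (X : Set (Fin n → ℝ)) (hX : IsCompact X)
    -- `X` is a compact `m`-dimensional smooth submanifold of `ℝ^n` satisfying
    -- property P at every point: each point has, after an orthogonal change of
    -- coordinates, a graph chart `(y, f(y))`, and some unit normal direction `u`
    -- makes the Hessian of `u·f` nonsingular at the corresponding point.
    (hchart : ∀ x ∈ X, ∃ O : Matrix (Fin n) (Fin n) ℝ,
      O ∈ Matrix.orthogonalGroup (Fin n) ℝ ∧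
      ∃ U : Set (Fin m → ℝ), IsOpen U ∧
      ∃ f : (Fin m → ℝ) → (Fin (n - m) → ℝ), ContDiffOn ℝ (⊤ : ℕ∞) f U ∧
      ∃ y₀ ∈ U, x = O.mulVec (appendV2 n m y₀ (f y₀)) ∧
      (∃ ε > (0 : ℝ), X ∩ Metric.ball x ε =
        (O.mulVec '' {p | ∃ y ∈ U, p = appendV2 n m y (f y)}) ∩ Metric.ball x ε) ∧
      (∃ u : Fin (n - m) → ℝ, (∑ i, u i ^ 2) = 1 ∧
        (hess (fun y => ∑ i, u i * f y i) y₀).det ≠ 0)) :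
    ∃ c > (0 : ℝ), ∃ κ > (0 : ℝ), ∃ C > (0 : ℝ), ∀ B : ℝ, 2 ≤ B →
      (NX X B : ℝ) ≤ C *
        (if m = 1 then B * Real.log B
         else if m = 2 then B ^ 2 * Real.exp (c * Real.sqrt (Real.log B))
         else B ^ m * Real.log B ^ κ) := by
  obtain ⟨c, hc, C, hC, h⟩ := exists_NX_le_of_local (m := m) hX fun x hx => by
    obtain ⟨O, hO, U, hU, f, hf, y₀, hy₀, hx₀, ⟨ε, hε, hball⟩, u, -, hu⟩ := hchart x hx
    exact exists_nhds_card_le hm hmn hO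
      ((hf.contDiffAt (hU.mem_nhds hy₀)).of_le
        (WithTop.coe_le_coe.mpr le_top : ((2 : ℕ∞) : WithTop ℕ∞) ≤ ((⊤ : ℕ∞) : WithTop ℕ∞)))
      hx₀ hε hball hu
  exact ⟨c, hc, 1, one_pos, C, hC, fun B hB => h B hB⟩
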